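/- arXiv:1302.5008 — 7 statements merged into one kernel-verified Lean document; each statement's English description precedes it below -/
import Mathlib

section
/- The homogeneous Euclidean algorithm 𝓘 : ℝ₊² → ℝ₊² is exact with respect to 2-dimensional Lebesgue measure: if A ⊆ ℝ₊² is Lebesgue-measurable and for every n ∈ ℕ there exists a Lebesgue-measurable set B_n ⊆ ℝ₊² with λ(A Δ 𝓘⁻ⁿ(B_n)) = 0 (symmetric difference of null measure), then λ(A) = 0 or λ(ℝ₊² ∖ A) = 0. -/
open MeasureTheory

/-- The positive cone `ℝ₊² = {(x₁,x₂) : x₁ ≥ 0, x₂ ≥ 0}`. -/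
def posQuad : Set (ℝ × ℝ) := {p | 0 ≤ p.1 ∧ 0 ≤ p.2}

/-- The homogeneous Euclidean algorithm:
`𝓘(x₁,x₂) = (x₁−x₂, x₂)` if `x₁ ≥ x₂`, and `(x₁, x₂−x₁)` otherwise. -/
noncomputable def euclidAlg (p : ℝ × ℝ) : ℝ × ℝ :=
  if p.2 ≤ p.1 then (p.1 - p.2, p.2) else (p.1, p.2 - p.1)

open Set Filter Topology

namespace EuclidExact

/-- Words in the two inverse branches, recorded by length and matrix entries. -/
inductive W : ℕ → ℕ → ℕ → ℕ → ℕ → Prop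
  | base : W 0 1 0 0 1
  | stepL {n a b c d : ℕ} : W n a b c d → W (n + 1) a (a + b) c (c + d)
  | stepR {n a b c d : ℕ} : W n a b c d → W (n + 1) (a + b) b (c + d) d

/-- Linear action of a two by two matrix. -/
def act (a b c d : ℝ) (x : ℝ × ℝ) : ℝ × ℝ := (a * x.1 + b * x.2, c * x.1 + d * x.2)

lemma W.det {n a b c d : ℕ} (h : W n a b c d) : a * d = b * c + 1 ∧ 1 ≤ a ∧ 1 ≤ d := by
  induction h with
  | base => simp
  | stepL h ih => obtain ⟨h1, h2, h3⟩ := ih; refine ⟨by linarith, h2, by omega⟩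
  | stepR h ih => obtain ⟨h1, h2, h3⟩ := ih; refine ⟨by linarith, by omega, h3⟩

lemma W.detR {n a b c d : ℕ} (h : W n a b c d) : (a : ℝ) * d = b * c + 1 := by
  exact_mod_cast h.det.1

lemma W.leftL {n a b c d : ℕ} (h : W n a b c d) : W (n + 1) (a + c) (b + d) c d := by
  induction h with
  | base => exact W.stepL W.base
  | @stepL n a b c d h ih =>
    have := W.stepL ih
    rwa [show a + c + (b + d) = a + b + (c + d) by ring] at this
  | @stepR n a b c d h ih =>
    have := W.stepR ih
    rwa [show a + c + (b + d) = a + b + (c + d) by ring] at this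

lemma W.powL (n : ℕ) : W n 1 n 0 1 := by
  induction n with
  | zero => exact W.base
  | succ n ih => have := W.stepL ih; rwa [add_comm 1 n] at this

lemma W.alg {n a b c d : ℕ} (h : W n a b c d) (x : ℝ × ℝ) (h1 : 0 < x.1) (h2 : 0 < x.2) :
    euclidAlg^[n] (act a b c d x) = x := by
  induction h generalizing x with
  | base => simp [act]
  | @stepL n a b c d h ih =>
    rw [Function.iterate_succ_apply']
    have := ih (x.1 + x.2, x.2) (by simp; linarith) h2
    have e : act a ((a + b : ℕ) : ℝ) c ((c + d : ℕ) : ℝ) x = act a b c d (x.1 + x.2, x.2) := by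
      simp only [act]; push_cast; ext <;> simp <;> ring
    rw [e, this]
    simp [euclidAlg, h1.le]
  | @stepR n a b c d h ih =>
    rw [Function.iterate_succ_apply']
    have := ih (x.1, x.1 + x.2) h1 (by simp; linarith)
    have e : act ((a + b : ℕ) : ℝ) b ((c + d : ℕ) : ℝ) d x = act a b c d (x.1, x.1 + x.2) := by
      simp only [act]; push_cast; ext <;> simp <;> ring
    rw [e, this]
    simp [euclidAlg, h2]

/-- From any state we may apply `L` at least once. -/
lemma exists_L {θ : ℝ} (hθ : Irrational θ) {n a b c d : ℕ} (h : W n a b c d)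
    (h1 : (c : ℝ) < a * θ) (h2 : b * θ < d) :
    ∃ n' a' b' c' d' : ℕ, W n' a' b' c' d' ∧ a ≤ a' ∧ (c' : ℝ) < a' * θ ∧ b' * θ < d' ∧
      ((a' + b' : ℕ) : ℝ) * θ < ((c' + d' : ℕ) : ℝ) := by
  obtain ⟨k, hk⟩ := exists_nat_gt ((a * θ - c) / (d - b * θ))
  rw [div_lt_iff₀ (by linarith)] at hk
  induction k generalizing n a c with
  | zero => simp at hk; linarith
  | succ k ih =>
    by_cases h3 : ((a + b : ℕ) : ℝ) * θ < ((c + d : ℕ) : ℝ)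
    · exact ⟨n, a, b, c, d, h, le_rfl, h1, h2, h3⟩
    · have hne : ((c + d : ℕ) : ℝ) ≠ ((a + b : ℕ) : ℝ) * θ := by
        have hp : a + b ≠ 0 := by have := h.det.2.1; omega
        exact fun e => (hθ.natCast_mul hp).ne_nat _ e.symm
      have h4 := lt_of_le_of_ne (not_lt.mp h3) hne
      obtain ⟨n', a', b', c', d', q1, q2, q3⟩ := ih (W.stepR h) h4 (by push_cast at hk ⊢; linarith)
      exact ⟨n', a', b', c', d', q1, by omega, q3⟩

lemma exists_R {θ : ℝ} (hθ : Irrational θ) {n a b c d : ℕ} (h : W n a b c d)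
    (h1 : (c : ℝ) < a * θ) (h2 : b * θ < d) (h3 : ((a + b : ℕ) : ℝ) * θ < ((c + d : ℕ) : ℝ)) :
    ∃ n' a' b' c' d' : ℕ, W n' a' b' c' d' ∧ a + 1 ≤ a' ∧ b' ≤ a' ∧ a' ≤ 2 * b' ∧
      (c' : ℝ) < a' * θ ∧ b' * θ < d' := by
  obtain ⟨k, hk⟩ := exists_nat_gt ((d - b * θ) / (a * θ - c))
  rw [div_lt_iff₀ (by linarith)] at hk
  have ha := h.det.2.1
  induction k generalizing n b d with
  | zero => simp at hk; linarith
  | succ k ih =>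
    by_cases h4 : ((a + (a + b) : ℕ) : ℝ) * θ < ((c + (c + d) : ℕ) : ℝ)
    · exact ih (W.stepL h) h3 h4 (by push_cast at hk ⊢; linarith)
    · have hne : ((c + (c + d) : ℕ) : ℝ) ≠ ((a + (a + b) : ℕ) : ℝ) * θ := by
        have hp : a + (a + b) ≠ 0 := by omega
        exact fun e => (hθ.natCast_mul hp).ne_nat _ e.symm
      have h5 := lt_of_le_of_ne (not_lt.mp h4) hne
      exact ⟨_, _, _, _, _, W.stepR (W.stepL h), by omega, by omega, by omega, h5, h3⟩

lemma exists_word {θ : ℝ} (hθ : Irrational θ) (h0 : 0 < θ) (N : ℕ) :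
    ∃ n a b c d : ℕ, W n a b c d ∧ N ≤ a ∧ b ≤ a ∧ a ≤ 2 * b ∧
      (c : ℝ) < a * θ ∧ b * θ < d := by
  have key : ∀ n a b c d : ℕ, W n a b c d → (c : ℝ) < a * θ → b * θ < d →
      ∃ n' a' b' c' d' : ℕ, W n' a' b' c' d' ∧ a + 1 ≤ a' ∧ b' ≤ a' ∧ a' ≤ 2 * b' ∧
      (c' : ℝ) < a' * θ ∧ b' * θ < d' := by
    intro n a b c d h h1 h2
    obtain ⟨n', a', b', c', d', q1, q2, q3, q4, q5⟩ := exists_L hθ h h1 h2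
    obtain ⟨n'', a'', b'', c'', d'', r1, r2, r3⟩ := exists_R hθ q1 q3 q4 q5
    exact ⟨n'', a'', b'', c'', d'', r1, by omega, r3⟩
  induction N with
  | zero =>
    obtain ⟨n', a', b', c', d', q1, q2, q3⟩ := key 0 1 0 0 1 W.base (by simpa) (by simp)
    exact ⟨n', a', b', c', d', q1, by omega, q3⟩
  | succ N ih =>
    obtain ⟨n, a, b, c, d, h, h1, h2, h3, h4, h5⟩ := ih
    obtain ⟨n', a', b', c', d', q1, q2, q3⟩ := key n a b c d h h4 h5
    exact ⟨n', a', b', c', d', q1, by omega, q3⟩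

/-! Measure-theoretic preliminaries. -/

lemma qmp_act (a b c d : ℝ) (h : a * d - b * c ≠ 0) :
    Measure.QuasiMeasurePreserving (act a b c d) volume volume := by
  have := Measure.LinearMap.quasiMeasurePreserving (volume : Measure (ℝ × ℝ))
    (Matrix.toLin (Module.Basis.finTwoProd ℝ) (Module.Basis.finTwoProd ℝ) !![a, b; c, d])
    (by rw [LinearMap.det_toLin, Matrix.det_fin_two_of]; exact h)
  convert this using 1
  ext x : 1
  rw [Matrix.toLin_finTwoProd_apply]; rfl

lemma qmp_affine (a b : ℝ) (h : a ≠ 0) :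
    Measure.QuasiMeasurePreserving (fun x : ℝ => b + a * x) volume volume := by
  have h1 : Measure.QuasiMeasurePreserving (fun x : ℝ => a * x) volume volume := by
    refine ⟨by fun_prop, ?_⟩
    rw [Real.map_volume_mul_left h]
    exact Measure.smul_absolutelyContinuous
  exact (measurePreserving_add_left volume b).quasiMeasurePreserving.comp h1

lemma coord {P : ℝ × ℝ → Prop} (h : ∀ᵐ x, P x) :
    ∀ᵐ θ : ℝ, ∀ᵐ r : ℝ, 0 < r → P (r, r * θ) := by
  obtain ⟨N, hN, hNm, hN0⟩ := exists_measurable_superset_of_null (ae_iff.mp h)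
  have h1 : ∀ᵐ x : ℝ × ℝ, x ∉ N := measure_eq_zero_iff_ae_notMem.mp hN0
  have h2 : ∀ᵐ r : ℝ, ∀ᵐ y : ℝ, (r, y) ∉ N := Measure.ae_ae_of_ae_prod h1
  have h3 : ∀ᵐ r : ℝ, ∀ᵐ θ : ℝ, 0 < r → (r, r * θ) ∉ N := by
    filter_upwards [h2] with r hr
    by_cases h0 : 0 < r
    · filter_upwards [(qmp_affine r 0 h0.ne').ae hr] with θ hθ _
      simpa using hθ
    · exact Eventually.of_forall fun θ h => absurd h h0
  rw [Measure.ae_ae_comm] at h3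
  · filter_upwards [h3] with θ hθ
    filter_upwards [hθ] with r hr h0
    by_contra hc
    exact hr h0 (hN hc)
  · have e : {x : ℝ × ℝ | 0 < x.1 → (x.1, x.1 * x.2) ∉ N}
        = {x : ℝ × ℝ | 0 < x.1}ᶜ ∪ ((fun x : ℝ × ℝ => (x.1, x.1 * x.2)) ⁻¹' N)ᶜ := by
      ext x; simp [imp_iff_not_or]
    rw [e]
    exact (measurableSet_lt measurable_const measurable_fst).compl.union
      ((by fun_prop : Measurable fun x : ℝ × ℝ => (x.1, x.1 * x.2)) hNm).compl

lemma coord_inv {P : ℝ × ℝ → Prop} (hP : MeasurableSet {x | P x})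
    (h : ∀ᵐ θ : ℝ, 0 < θ → ∀ᵐ r : ℝ, 0 < r → P (r, r * θ)) :
    ∀ᵐ x : ℝ × ℝ, 0 < x.1 → 0 < x.2 → P x := by
  have hm : MeasurableSet {x : ℝ × ℝ | 0 < x.1 → 0 < x.2 → P x} := by
    have e : {x : ℝ × ℝ | 0 < x.1 → 0 < x.2 → P x}
        = {x : ℝ × ℝ | 0 < x.1}ᶜ ∪ ({x : ℝ × ℝ | 0 < x.2}ᶜ ∪ {x | P x}) := by
      ext x; simp only [mem_ofPred_eq, mem_union, mem_compl_iff]; tauto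
    rw [e]
    exact (measurableSet_lt measurable_const measurable_fst).compl.union
      ((measurableSet_lt measurable_const measurable_snd).compl.union hP)
  have h1 : ∀ᵐ θ : ℝ, ∀ᵐ r : ℝ, 0 < r → 0 < r * θ → P (r, r * θ) := by
    filter_upwards [h] with θ hθ
    by_cases h0 : 0 < θ
    · filter_upwards [hθ h0] with r hr h1 _ using hr h1
    · refine Eventually.of_forall fun r hr h2 => absurd ((pos_iff_pos_of_mul_pos h2).mp hr) h0
  rw [Measure.ae_ae_comm] at h1
  · refine (Measure.ae_prod_iff_ae_ae (μ := (volume : Measure ℝ)) (ν := (volume : Measure ℝ)) hm).mpr ?_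
    filter_upwards [h1] with r hr
    by_cases h0 : 0 < r
    · filter_upwards [(qmp_affine r⁻¹ 0 (inv_ne_zero h0.ne')).ae hr] with y hy _ h2
      have e : r * (0 + r⁻¹ * y) = y := by field_simp; simp
      rw [e] at hy
      exact hy h0 h2
    · exact Eventually.of_forall fun y h => absurd h h0
  · exact (by fun_prop : Measurable fun x : ℝ × ℝ => (x.2, x.2 * x.1)) hm

lemma dens (h : ℝ → ℝ) (hi : LocallyIntegrable h) :
    ∀ᵐ x₀ : ℝ, ∀ ε > 0, ∃ δ > 0, ∀ p q : ℝ, p < q → q - p < δ → p ≤ x₀ → x₀ ≤ q →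
      ∫⁻ x in Icc p q, ENNReal.ofReal |h x - h x₀| ≤ ENNReal.ofReal (ε * (q - p)) := by
  filter_upwards [IsUnifLocDoublingMeasure.ae_tendsto_average_norm_sub volume hi 1] with x₀ hx ε hε
  by_contra! hc
  have hc' : ∀ n : ℕ, ∃ p q : ℝ, p < q ∧ q - p < 1 / ((n : ℝ) + 1) ∧ p ≤ x₀ ∧ x₀ ≤ q ∧
      ENNReal.ofReal (ε * (q - p)) < ∫⁻ x in Icc p q, ENNReal.ofReal |h x - h x₀| :=
    fun n => hc _ (by positivity)
  choose p q h1 h2 h3 h4 h5 using hc'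
  have ball : ∀ n, Metric.closedBall ((p n + q n) / 2) ((q n - p n) / 2) = Icc (p n) (q n) := by
    intro n; rw [Real.closedBall_eq_Icc]; congr 1 <;> ring
  have lim := hx (l := atTop) (fun n => (p n + q n) / 2) (fun n => (q n - p n) / 2) (by
      rw [tendsto_nhdsWithin_iff]
      refine ⟨squeeze_zero (fun n => by linarith [h1 n]) (fun n => by linarith [h1 n, h2 n])
        tendsto_one_div_add_atTop_nhds_zero_nat, Eventually.of_forall fun n => ?_⟩
      simp only [mem_Ioi]; linarith [h1 n])
    (Eventually.of_forall fun n => by rw [one_mul, ball]; exact ⟨h3 n, h4 n⟩)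
  obtain ⟨n, hn⟩ := (lim.eventually (gt_mem_nhds hε)).exists
  rw [ball, setAverage_eq, smul_eq_mul, Measure.real, Real.volume_Icc,
    ENNReal.toReal_ofReal (by linarith [h1 n]), inv_mul_lt_iff₀ (by linarith [h1 n])] at hn
  have hint : IntegrableOn (fun x => ‖h x - h x₀‖) (Icc (p n) (q n)) :=
    ((hi.integrableOn_isCompact isCompact_Icc).sub (integrableOn_const (by simp))).norm
  have := h5 n
  simp only [← Real.norm_eq_abs] at this
  rw [← ofReal_integral_eq_lintegral_ofReal hint (Eventually.of_forall fun x => norm_nonneg _)] at this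
  have := (ENNReal.ofReal_lt_ofReal_iff_of_nonneg (by nlinarith [h1 n])).mp this
  linarith

lemma pull {F F' : ℝ → ℝ} {s J : Set ℝ} (hs : MeasurableSet s)
    (hd : ∀ x ∈ s, HasDerivAt F (F' x) x) (hinj : InjOn F s) (hmap : MapsTo F s J)
    {m : ℝ} (hm : ∀ x ∈ s, m ≤ F' x) (g : ℝ → ENNReal) :
    ENNReal.ofReal m * ∫⁻ x in s, g (F x) ≤ ∫⁻ x in J, g x := by
  calc _ = ∫⁻ x in s, ENNReal.ofReal m * g (F x) := by
        rw [lintegral_const_mul' _ _ ENNReal.ofReal_ne_top]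
    _ ≤ ∫⁻ x in s, ENNReal.ofReal |F' x| * g (F x) := by
        refine setLIntegral_mono' hs fun x hx => ?_
        gcongr
        exact (hm x hx).trans (le_abs_self _)
    _ = ∫⁻ x in F '' s, g x :=
        (lintegral_image_eq_lintegral_abs_deriv_mul hs (fun x hx => (hd x hx).hasDerivWithinAt)
          hinj g).symm
    _ ≤ _ := lintegral_mono_set hmap.image_subset

/-- Radial primitive of `f` along the ray of slope `θ`. -/
noncomputable def Phi (f : ℝ × ℝ → ℝ) (s θ : ℝ) : ℝ := ∫ r in (0 : ℝ)..s, f (r, r * θ)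

lemma Phi_ii {f : ℝ × ℝ → ℝ} (hf : Measurable f) (hb : ∀ x, 0 ≤ f x ∧ f x ≤ 1) (θ a b : ℝ) :
    IntervalIntegrable (fun r => f (r, r * θ)) volume a b := by
  refine (intervalIntegrable_const (c := (1 : ℝ))).mono_fun ?_ ?_
  · exact (by fun_prop : Measurable fun r => f (r, r * θ)).aestronglyMeasurable
  · refine Eventually.of_forall fun r => ?_
    simp only [Real.norm_eq_abs, abs_one]
    rw [abs_of_nonneg (hb _).1]; exact (hb _).2

lemma Phi_sub {f : ℝ × ℝ → ℝ} (hf : Measurable f) (hb : ∀ x, 0 ≤ f x ∧ f x ≤ 1) (θ s s' : ℝ) :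
    |Phi f s' θ - Phi f s θ| ≤ |s' - s| := by
  unfold Phi
  rw [intervalIntegral.integral_interval_sub_left (Phi_ii hf hb _ _ _) (Phi_ii hf hb _ _ _)]
  have := intervalIntegral.norm_integral_le_of_norm_le_const (a := s) (b := s') (C := 1)
    (f := fun r => f (r, r * θ))
    (fun r _ => by rw [Real.norm_eq_abs, abs_of_nonneg (hb _).1]; exact (hb _).2)
  simpa using this

lemma Phi_bd {f : ℝ × ℝ → ℝ} (hf : Measurable f) (hb : ∀ x, 0 ≤ f x ∧ f x ≤ 1) (θ s : ℝ) :
    |Phi f s θ| ≤ |s| := by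
  have := Phi_sub hf hb θ 0 s
  simpa [Phi] using this

lemma Phi_meas {f : ℝ × ℝ → ℝ} (hf : Measurable f) (s : ℝ) : Measurable (Phi f s) := by
  have h : ∀ t : Set ℝ, Measurable fun θ : ℝ => ∫ r in t, f (r, r * θ) := by
    intro t
    have : StronglyMeasurable (Function.uncurry fun (θ r : ℝ) => f (r, r * θ)) := by
      apply Measurable.stronglyMeasurable
      simp only [Function.uncurry_def]
      fun_prop
    exact this.integral_prod_right.measurable
  exact (h _).sub (h _)

lemma Phi_li {f : ℝ × ℝ → ℝ} (hf : Measurable f) (hb : ∀ x, 0 ≤ f x ∧ f x ≤ 1) (s : ℝ) :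
    LocallyIntegrable (Phi f s) := by
  refine (locallyIntegrable_const (|s|)).mono (Phi_meas hf s).aestronglyMeasurable
    (Eventually.of_forall fun θ => ?_)
  simpa using Phi_bd hf hb θ s

lemma word_identity {f : ℝ × ℝ → ℝ}
    (H : ∀ n a b c d a' b' c' d' : ℕ, W n a b c d → W n a' b' c' d' →
      ∀ᵐ x : ℝ × ℝ, 0 < x.1 → 0 < x.2 → f (act a b c d x) = f (act a' b' c' d' x))
    {n a b c d : ℕ} (hw : W n a b c d) :
    ∀ᵐ θ : ℝ, (c : ℝ) < a * θ → b * θ < d → ∀ s : ℝ, 0 ≤ s →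
      Phi (fun x => f (x.1 + x.2, x.2)) s θ = (1 + a * (a * θ - c))⁻¹ *
        Phi f ((1 + a * (a * θ - c)) * s)
          (c / a + ((a * (a * θ - c)) / (1 + a * (a * θ - c))) / a ^ 2) := by
  have hdet := hw.detR
  have ha : (0 : ℝ) < a := by exact_mod_cast hw.det.2.1
  have h1 := H _ _ _ _ _ _ _ _ _ hw.leftL hw.stepL
  have h2 := coord ((qmp_act d (-b) (-c) a (by rw [neg_mul_neg]; linarith)).ae h1)
  filter_upwards [h2] with θ h3 hc hd s hs
  have hy : 0 < (a : ℝ) * (a * θ - c) := mul_pos ha (by linarith)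
  set y : ℝ := (a : ℝ) * (a * θ - c) with hyd
  set θ' : ℝ := c / a + (y / (1 + y)) / a ^ 2 with hθ'
  have e1 : (1 + y) * θ' = θ + c * (a * θ - c) := by
    rw [hθ']; have : (1 + y) ≠ 0 := by positivity
    field_simp
    rw [hyd]; ring
  have : Phi (fun x => f (x.1 + x.2, x.2)) s θ
      = ∫ r in (0 : ℝ)..s, (fun r => f (r, r * θ')) ((1 + y) * r) := by
    unfold Phi
    refine intervalIntegral.integral_congr_ae ?_
    filter_upwards [h3] with r hr hrs
    rw [uIoc_of_le hs] at hrs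
    have h4 := hr hrs.1
      (by simp only [act]; nlinarith [hrs.1, mul_pos hrs.1 (show (0 : ℝ) < d - b * θ by linarith)])
      (by simp only [act]; nlinarith [hrs.1, mul_pos hrs.1 (show (0 : ℝ) < a * θ - c by linarith)])
    have e2 : act ((a + c : ℕ) : ℝ) ((b + d : ℕ) : ℝ) c d (act d (-b) (-c) a (r, r * θ))
        = (r + r * θ, r * θ) := by
      simp only [act]; push_cast
      ext
      · simp only; linear_combination (r + r * θ) * hdet
      · simp only; linear_combination (r * θ) * hdet
    have e3 : act a ((a + b : ℕ) : ℝ) c ((c + d : ℕ) : ℝ) (act d (-b) (-c) a (r, r * θ))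
        = ((1 + y) * r, (1 + y) * r * θ') := by
      rw [mul_right_comm, e1]
      simp only [act]; push_cast
      ext
      · simp only; rw [hyd]; linear_combination r * hdet
      · simp only; linear_combination (r * θ) * hdet
    rw [e2, e3] at h4
    exact h4
  rw [this, intervalIntegral.integral_comp_mul_left (fun r => f (r, r * θ')) (by positivity)]
  simp [Phi]

lemma cancel {m v : ℝ} (hm : 0 < m) {X : ENNReal}
    (h : ENNReal.ofReal m * X ≤ ENNReal.ofReal (m * v)) : X ≤ ENNReal.ofReal v := by
  rw [ENNReal.ofReal_mul hm.le] at h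
  exact (ENNReal.mul_le_mul_iff_right (by simpa using hm) ENNReal.ofReal_ne_top).mp h

lemma ae_irrational : ∀ᵐ θ : ℝ, Irrational θ :=
  (countable_range ((↑) : ℚ → ℝ)).ae_notMem volume

lemma middle {f : ℝ × ℝ → ℝ} (hf : Measurable f) (hb : ∀ x, 0 ≤ f x ∧ f x ≤ 1)
    {s t y ε : ℝ} (hs : 0 ≤ s) (ht : 0 ≤ t) (ht' : t ≤ 1 / 2) (h1 : t ≤ y) (h2 : y ≤ t + ε) (θ : ℝ) :
    |(1 + y)⁻¹ * Phi f ((1 + y) * s) θ - (1 + t)⁻¹ * Phi f ((1 + t) * s) θ| ≤ 3 * s * ε := by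
  have hX := Phi_sub hf hb θ ((1 + t) * s) ((1 + y) * s)
  have hY := Phi_bd hf hb θ ((1 + t) * s)
  set X := Phi f ((1 + y) * s) θ
  set Y := Phi f ((1 + t) * s) θ
  rw [abs_of_nonneg (by nlinarith : 0 ≤ (1 + y) * s - (1 + t) * s)] at hX
  rw [abs_of_nonneg (by positivity : 0 ≤ (1 + t) * s)] at hY
  have hu : 0 < (1 + y)⁻¹ := by have : 0 < 1 + y := by linarith
                                positivity
  have hu' : (1 + y)⁻¹ ≤ 1 := inv_le_one_of_one_le₀ (by linarith)
  have huv : |(1 + y)⁻¹ - (1 + t)⁻¹| ≤ ε := by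
    have e : (1 + y)⁻¹ - (1 + t)⁻¹ = -((y - t) * ((1 + y)⁻¹ * (1 + t)⁻¹)) := by
      have : (1 + y) ≠ 0 := by linarith
      have : (1 + t) ≠ 0 := by linarith
      field_simp; ring
    have hv : 0 < (1 + t)⁻¹ := by positivity
    have hv' : (1 + t)⁻¹ ≤ 1 := inv_le_one_of_one_le₀ (by linarith)
    have hp : (1 + y)⁻¹ * (1 + t)⁻¹ ≤ 1 := mul_le_one₀ hu' hv.le hv'
    rw [e, abs_neg, abs_of_nonneg (mul_nonneg (by linarith) (by positivity))]
    nlinarith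
  have e : (1 + y)⁻¹ * X - (1 + t)⁻¹ * Y = (1 + y)⁻¹ * (X - Y) + Y * ((1 + y)⁻¹ - (1 + t)⁻¹) := by
    ring
  rw [e]
  have hε : 0 ≤ ε := by linarith
  calc _ ≤ |(1 + y)⁻¹ * (X - Y)| + |Y * ((1 + y)⁻¹ - (1 + t)⁻¹)| := abs_add_le _ _
    _ = (1 + y)⁻¹ * |X - Y| + |Y| * |(1 + y)⁻¹ - (1 + t)⁻¹| := by
        rw [abs_mul, abs_mul, abs_of_pos hu]
    _ ≤ 1 * (s * ε) + (2 * s) * ε := by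
        refine add_le_add ?_ ?_
        · exact mul_le_mul hu' (by nlinarith) (abs_nonneg _) zero_le_one
        · exact mul_le_mul (by nlinarith) huv (abs_nonneg _) (by positivity)
    _ = _ := by ring

lemma word_size {a b c d : ℕ} {θ : ℝ} (hdet : (a : ℝ) * d = b * c + 1) (ha : (0 : ℝ) < a)
    (hab : a ≤ 2 * b) (h1 : (c : ℝ) < a * θ) (h2 : b * θ < d) :
    (c : ℝ) / a ≤ θ ∧ θ ≤ c / a + 2 / a ^ 2 := by
  have hab' : (a : ℝ) ≤ 2 * b := by exact_mod_cast hab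
  constructor
  · rw [div_le_iff₀ ha]; linarith
  · have h3 : (b : ℝ) * (a * θ - c) ≤ 1 := by nlinarith
    have h4 : (a : ℝ) * (a * θ - c) ≤ 2 := by nlinarith
    have e : (c : ℝ) / a + 2 / a ^ 2 = (a * c + 2) / a ^ 2 := by field_simp
    rw [e, le_div_iff₀ (by positivity)]
    nlinarith

lemma stepA {f : ℝ × ℝ → ℝ} (hf : Measurable f) (hb : ∀ x, 0 ≤ f x ∧ f x ≤ 1)
    (H : ∀ n a b c d a' b' c' d' : ℕ, W n a b c d → W n a' b' c' d' →
      ∀ᵐ x : ℝ × ℝ, 0 < x.1 → 0 < x.2 → f (act a b c d x) = f (act a' b' c' d' x))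
    {s t : ℝ} (hs : 0 ≤ s) (ht : 0 ≤ t) (ht' : t ≤ 1 / 2) :
    ∀ᵐ θ : ℝ, 0 < θ → Phi (fun x => f (x.1 + x.2, x.2)) s θ
      = (1 + t)⁻¹ * Phi f ((1 + t) * s) θ := by
  have hfL : Measurable fun x : ℝ × ℝ => f (x.1 + x.2, x.2) := by fun_prop
  have hbL : ∀ x : ℝ × ℝ, 0 ≤ f (x.1 + x.2, x.2) ∧ f (x.1 + x.2, x.2) ≤ 1 := fun x => hb _
  filter_upwards [dens _ (Phi_li hfL hbL s), dens _ (Phi_li hf hb ((1 + t) * s)), ae_irrational]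
    with θ₀ d1 d2 hirr h0
  set G := Phi (fun x => f (x.1 + x.2, x.2)) s with hG
  set P := Phi f ((1 + t) * s) with hP
  have hGm : Measurable G := Phi_meas hfL s
  have hPm : Measurable P := Phi_meas hf _
  have claim : ∀ ε > 0, ε ≤ 1 / 4 → |G θ₀ - (1 + t)⁻¹ * P θ₀| ≤ (10 + 3 * s) * ε := by
    intro ε hε hε4
    obtain ⟨δ₁, hδ₁, k1⟩ := d1 (ε ^ 2) (by positivity)
    obtain ⟨δ₂, hδ₂, k2⟩ := d2 (ε ^ 2) (by positivity)
    obtain ⟨N, hN⟩ := exists_nat_gt (2 / min δ₁ δ₂)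
    obtain ⟨n, a, b, c, d, hw, hNa, hba, hab, hc, hd⟩ := exists_word hirr h0 N
    have hdet := hw.detR
    have ha1 : (1 : ℝ) ≤ a := by exact_mod_cast hw.det.2.1
    have ha : (0 : ℝ) < a := by linarith
    have hba' : (b : ℝ) ≤ a := by exact_mod_cast hba
    have hsmall : 2 / (a : ℝ) ^ 2 < min δ₁ δ₂ := by
      have hmin : 0 < min δ₁ δ₂ := lt_min hδ₁ hδ₂
      rw [div_lt_iff₀ hmin] at hN
      rw [div_lt_iff₀ (by positivity)]
      have : (N : ℝ) ≤ a := by exact_mod_cast hNa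
      nlinarith [mul_le_mul_of_nonneg_right this hmin.le, mul_le_mul_of_nonneg_left ha1 (mul_pos hmin ha).le]
    obtain ⟨w1, w2⟩ := word_size hdet ha hab hc hd
    have hpos : (0 : ℝ) < 2 / a ^ 2 := by positivity
    have K1 := k1 (c / a) (c / a + 2 / a ^ 2) (by linarith)
      (by linarith [min_le_left δ₁ δ₂]) w1 w2
    have K2 := k2 (c / a) (c / a + 2 / a ^ 2) (by linarith)
      (by linarith [min_le_right δ₁ δ₂]) w1 w2
    rw [add_sub_cancel_left] at K1 K2
    -- first window
    have I1 : ∫⁻ y in Ioc t (t + ε), ENNReal.ofReal |G (c / a + (a ^ 2 : ℝ)⁻¹ * y) - G θ₀|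
        ≤ ENNReal.ofReal (2 * ε ^ 2) := by
      refine cancel (m := (a ^ 2 : ℝ)⁻¹) (by positivity) ?_
      refine (pull (F := fun y => c / a + (a ^ 2 : ℝ)⁻¹ * y) (F' := fun _ => (a ^ 2 : ℝ)⁻¹)
        (J := Icc ((c : ℝ) / a) (c / a + 2 / a ^ 2)) (m := (a ^ 2 : ℝ)⁻¹)
        measurableSet_Ioc ?_ ?_ ?_ (fun _ _ => le_rfl)
        (fun x => ENNReal.ofReal |G x - G θ₀|)).trans (K1.trans_eq ?_)
      · intro y _
        simpa using ((hasDerivAt_id y).const_mul ((a ^ 2 : ℝ)⁻¹)).const_add ((c : ℝ) / a)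
      · intro y _ z _ hyz
        have h3 : (a ^ 2 : ℝ)⁻¹ ≠ 0 := by positivity
        simpa [h3, ha.ne'] using hyz
      · intro y hy
        have h3 : (0 : ℝ) < (a ^ 2 : ℝ)⁻¹ := by positivity
        refine ⟨?_, ?_⟩
        · have : 0 ≤ (a ^ 2 : ℝ)⁻¹ * y := mul_nonneg h3.le (by linarith [hy.1])
          simp only; linarith
        · have : (a ^ 2 : ℝ)⁻¹ * y ≤ (a ^ 2 : ℝ)⁻¹ * 2 :=
            mul_le_mul_of_nonneg_left (by linarith [hy.2]) h3.le
          simp only; rw [div_eq_mul_inv 2, mul_comm 2]; linarith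
      · congr 1; field_simp
    -- second window
    have I2 : ∫⁻ y in Ioc t (t + ε), ENNReal.ofReal |P (c / a + (y / (1 + y)) / a ^ 2) - P θ₀|
        ≤ ENNReal.ofReal (8 * ε ^ 2) := by
      refine cancel (m := 1 / 4 * (a ^ 2 : ℝ)⁻¹) (by positivity) ?_
      refine (pull (F := fun y => c / a + (y / (1 + y)) / a ^ 2)
        (F' := fun y => (1 / (1 + y) ^ 2) / (a ^ 2 : ℝ))
        (J := Icc ((c : ℝ) / a) (c / a + 2 / a ^ 2)) (m := 1 / 4 * (a ^ 2 : ℝ)⁻¹)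
        measurableSet_Ioc ?_ ?_ ?_ ?_
        (fun x => ENNReal.ofReal |P x - P θ₀|)).trans (K2.trans_eq ?_)
      · intro y hy
        have h3 : 1 + y ≠ 0 := by linarith [hy.1]
        have := ((hasDerivAt_id y).div ((hasDerivAt_id y).const_add 1) h3)
        have := (this.div_const ((a : ℝ) ^ 2)).const_add ((c : ℝ) / a)
        refine HasDerivAt.congr_deriv this ?_
        simp
      · intro y hy z hz hyz
        have h3 : 1 + y ≠ 0 := by linarith [hy.1]
        have h4 : 1 + z ≠ 0 := by linarith [hz.1]
        have hyz : y / (1 + y) / (a : ℝ) ^ 2 = z / (1 + z) / (a : ℝ) ^ 2 := add_left_cancel hyz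
        rw [div_left_inj' (by positivity), div_eq_div_iff h3 h4] at hyz
        linarith
      · intro y hy
        have hy0 : 0 ≤ y := by linarith [hy.1]
        have h5 : y / (1 + y) ≤ 2 := by rw [div_le_iff₀ (by linarith)]; linarith
        refine ⟨?_, ?_⟩
        · have : 0 ≤ (y / (1 + y)) / (a : ℝ) ^ 2 := by positivity
          simp only; linarith
        · have : (y / (1 + y)) / (a : ℝ) ^ 2 ≤ 2 / a ^ 2 := by gcongr
          simp only; linarith
      · intro y hy
        have hy0 : 0 ≤ y := by linarith [hy.1]
        have hy1 : y ≤ 1 := by linarith [hy.2]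
        rw [← div_eq_mul_inv]
        gcongr
        nlinarith
      · congr 1; field_simp; norm_num
    -- pointwise estimate
    have hid := (qmp_affine (a ^ 2 : ℝ)⁻¹ (c / a) (by positivity)).ae (word_identity H hw)
    have hpt : ∀ᵐ y ∂(volume.restrict (Ioc t (t + ε))),
        ENNReal.ofReal |G θ₀ - (1 + t)⁻¹ * P θ₀| ≤
          ENNReal.ofReal |G (c / a + (a ^ 2 : ℝ)⁻¹ * y) - G θ₀| +
          ENNReal.ofReal |P (c / a + (y / (1 + y)) / a ^ 2) - P θ₀| +
          ENNReal.ofReal (3 * s * ε) := by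
      rw [ae_restrict_iff' measurableSet_Ioc]
      filter_upwards [hid] with y hy hyI
      have hy0 : 0 < y := by linarith [hyI.1]
      have e1 : (a : ℝ) * (c / a + (a ^ 2 : ℝ)⁻¹ * y) - c = y / a := by field_simp; ring
      have e2 : (a : ℝ) * (a * (c / a + (a ^ 2 : ℝ)⁻¹ * y) - c) = y := by rw [e1]; field_simp
      have e3 : 0 < y / a := by positivity
      have e4 : (b : ℝ) * (c / a + (a ^ 2 : ℝ)⁻¹ * y) < d := by
        have : (b : ℝ) * (c / a + (a ^ 2 : ℝ)⁻¹ * y) = (b * c + b * y / a) / a := by field_simp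
        rw [this, div_lt_iff₀ ha, mul_comm (d : ℝ), hdet]
        have : (b : ℝ) * y / a < 1 := by
          rw [div_lt_iff₀ ha]
          have : y < 1 := by linarith [hyI.2]
          nlinarith [mul_le_mul_of_nonneg_right hba' hy0.le]
        linarith
      have h5 := hy (by linarith) e4 s hs
      rw [e2] at h5
      have h6 := middle hf hb hs ht ht' hyI.1.le hyI.2 (c / a + (y / (1 + y)) / a ^ 2)
      rw [← h5] at h6
      rw [← ENNReal.ofReal_add (abs_nonneg _) (abs_nonneg _),
        ← ENNReal.ofReal_add (by positivity) (by positivity)]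
      apply ENNReal.ofReal_le_ofReal
      change |G _ - (1 + t)⁻¹ * P _| ≤ _ at h6
      set g := G (c / a + (a ^ 2 : ℝ)⁻¹ * y)
      set p := P (c / a + (y / (1 + y)) / a ^ 2)
      have hv : 0 < (1 + t)⁻¹ := by positivity
      have hv' : (1 + t)⁻¹ ≤ 1 := inv_le_one_of_one_le₀ (by linarith)
      have h7 : |(1 + t)⁻¹ * (p - P θ₀)| ≤ |p - P θ₀| := by
        rw [abs_mul, abs_of_pos hv]
        exact mul_le_of_le_one_left (abs_nonneg _) hv'
      calc |G θ₀ - (1 + t)⁻¹ * P θ₀|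
          = |-(g - G θ₀) + (1 + t)⁻¹ * (p - P θ₀) + (g - (1 + t)⁻¹ * p)| := by congr 1; ring
        _ ≤ |-(g - G θ₀)| + |(1 + t)⁻¹ * (p - P θ₀)| + |g - (1 + t)⁻¹ * p| := abs_add_three _ _ _
        _ ≤ _ := by rw [abs_neg]; gcongr
    have hint := lintegral_mono_ae hpt
    rw [lintegral_add_right _ measurable_const, lintegral_add_left (by fun_prop)] at hint
    simp only [lintegral_const, Measure.restrict_apply_univ, Real.volume_Ioc,
      add_sub_cancel_left] at hint
    have hint := hint.trans (add_le_add (add_le_add I1 I2) le_rfl)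
    rw [← ENNReal.ofReal_mul (abs_nonneg _), ← ENNReal.ofReal_mul (by positivity),
      ← ENNReal.ofReal_add (by positivity) (by positivity),
      ← ENNReal.ofReal_add (by positivity) (by positivity),
      ENNReal.ofReal_le_ofReal_iff (by positivity)] at hint
    refine le_of_mul_le_mul_right (hint.trans_eq ?_) hε
    ring
  by_contra hne
  have hD : 0 < |G θ₀ - (1 + t)⁻¹ * P θ₀| := abs_pos.mpr (sub_ne_zero.mpr hne)
  set D := |G θ₀ - (1 + t)⁻¹ * P θ₀|
  have hC : 0 < 10 + 3 * s := by positivity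
  have := claim (min (1 / 4) (D / (2 * (10 + 3 * s)))) (by positivity) (min_le_left _ _)
  have h2 : (10 + 3 * s) * min (1 / 4) (D / (2 * (10 + 3 * s))) ≤ D / 2 := by
    calc _ ≤ (10 + 3 * s) * (D / (2 * (10 + 3 * s))) := by gcongr; exact min_le_right _ _
      _ = _ := by field_simp
  linarith

lemma uniq {u v : ℝ → ℝ} (hu : LocallyIntegrable u) (hv : LocallyIntegrable v)
    (h : ∀ s : ℝ, 0 ≤ s → ∫ r in (0 : ℝ)..s, u r = ∫ r in (0 : ℝ)..s, v r) :
    ∀ᵐ r : ℝ, 0 < r → u r = v r := by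
  filter_upwards [LocallyIntegrable.ae_hasDerivAt_integral hu, LocallyIntegrable.ae_hasDerivAt_integral hv] with r h1 h2 h0
  refine (h1 0).unique ((h2 0).congr_of_eventuallyEq ?_)
  filter_upwards [lt_mem_nhds h0] with s hs using h s hs.le

lemma ray_li {f : ℝ × ℝ → ℝ} (hf : Measurable f) (hb : ∀ x, 0 ≤ f x ∧ f x ≤ 1) (θ : ℝ) :
    LocallyIntegrable fun r => f (r, r * θ) := by
  refine (locallyIntegrable_const (1 : ℝ)).mono
    (by fun_prop : Measurable fun r => f (r, r * θ)).aestronglyMeasurable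
    (Eventually.of_forall fun r => ?_)
  rw [Real.norm_eq_abs, abs_of_nonneg (hb _).1]
  simpa using (hb _).2

lemma Phi_cont {f : ℝ × ℝ → ℝ} (hf : Measurable f) (hb : ∀ x, 0 ≤ f x ∧ f x ≤ 1) (θ : ℝ) :
    Continuous fun s => Phi f s θ :=
  intervalIntegral.continuous_primitive (fun a b => Phi_ii hf hb θ a b) 0

lemma hom_of_rat {φ : ℝ → ℝ}
    (h : ∀ q t : ℚ, 0 ≤ q → 0 ≤ t → t ≤ 1 / 2 → φ ((1 + t) * q) = (1 + t) * φ q) (q : ℚ)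
    (hq : 0 ≤ q) : φ q = q * φ 1 := by
  have key : ∀ (n : ℕ) (m q : ℚ), 0 ≤ q → 1 ≤ m → m ≤ (3 / 2) ^ n →
      φ ((m * q : ℚ)) = m * φ q := by
    intro n
    induction n with
    | zero =>
      intro m q _ h1 h2
      have : m = 1 := le_antisymm (by simpa using h2) h1
      simp [this]
    | succ n ih =>
      intro m q hq h1 h2
      rcases le_total m (3 / 2) with h3 | h3
      · have := h q (m - 1) hq (by linarith) (by linarith)
        push_cast at this ⊢
        simpa using this
      · have h4 := ih (m / (3 / 2)) (3 / 2 * q) (by positivity) (by linarith)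
          (by rw [pow_succ] at h2; linarith)
        have h5 := h q (1 / 2) hq (by norm_num) le_rfl
        rw [show m / (3 / 2) * (3 / 2 * q) = m * q by ring] at h4
        rw [h4]
        push_cast at h5 ⊢
        rw [show (1 + 1 / 2 : ℝ) = 3 / 2 by norm_num] at h5
        rw [h5]; ring
  rcases hq.eq_or_lt with rfl | hq
  · have := h 0 (1 / 2) le_rfl (by norm_num) le_rfl
    simp at this ⊢
    linarith
  · rcases le_total 1 q with h1 | h1
    · obtain ⟨n, hn⟩ := pow_unbounded_of_one_lt q (show (1 : ℚ) < 3 / 2 by norm_num)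
      have := key n q 1 zero_le_one h1 hn.le
      simpa using this
    · obtain ⟨n, hn⟩ := pow_unbounded_of_one_lt (1 / q) (show (1 : ℚ) < 3 / 2 by norm_num)
      have := key n (1 / q) q hq.le (by rw [le_div_iff₀ hq]; linarith) hn.le
      rw [one_div, inv_mul_cancel₀ hq.ne'] at this
      have hq' : (q : ℝ) ≠ 0 := by exact_mod_cast hq.ne'
      push_cast at this
      rw [this]; field_simp

lemma ext_rat {u v : ℝ → ℝ} (hu : Continuous u) (hv : Continuous v)
    (h : ∀ q : ℚ, 0 ≤ q → u q = v q) (s : ℝ) (hs : 0 ≤ s) : u s = v s := by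
  have := Rat.denseRange_cast (𝕜 := ℝ).equalizer (hu.comp continuous_abs) (hv.comp continuous_abs)
    (funext fun q => by simpa using h |q| (abs_nonneg q))
  simpa [abs_of_nonneg hs] using congrFun this s

lemma stepA_all {f : ℝ × ℝ → ℝ} (hf : Measurable f) (hb : ∀ x, 0 ≤ f x ∧ f x ≤ 1)
    (H : ∀ n a b c d a' b' c' d' : ℕ, W n a b c d → W n a' b' c' d' →
      ∀ᵐ x : ℝ × ℝ, 0 < x.1 → 0 < x.2 → f (act a b c d x) = f (act a' b' c' d' x)) : ∀ᵐ θ : ℝ, 0 < θ → ∀ q t : ℚ, 0 ≤ q → 0 ≤ t → t ≤ 1 / 2 →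
    Phi (fun x => f (x.1 + x.2, x.2)) q θ = (1 + t : ℝ)⁻¹ * Phi f ((1 + t) * q) θ := by
  have : ∀ q t : ℚ, ∀ᵐ θ : ℝ, 0 < θ → 0 ≤ q → 0 ≤ t → t ≤ 1 / 2 →
      Phi (fun x => f (x.1 + x.2, x.2)) q θ = (1 + t : ℝ)⁻¹ * Phi f ((1 + t) * q) θ := by
    intro q t
    by_cases h : 0 ≤ q ∧ 0 ≤ t ∧ t ≤ 1 / 2
    · filter_upwards [stepA hf hb H (s := q) (t := t) (by exact_mod_cast h.1)
        (by exact_mod_cast h.2.1) (by have := h.2.2; have : ((t : ℚ) : ℝ) ≤ ((1 / 2 : ℚ) : ℝ) := by exact_mod_cast this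
                                      simpa using this)] with θ hθ h0 _ _ _ using hθ h0
    · exact Eventually.of_forall fun θ _ h1 h2 h3 => absurd ⟨h1, h2, h3⟩ h
  have := ae_all_iff.mpr fun q => ae_all_iff.mpr (this q)
  filter_upwards [this] with θ hθ h0 q t using hθ q t h0

lemma homog {f : ℝ × ℝ → ℝ} (hf : Measurable f) (hb : ∀ x, 0 ≤ f x ∧ f x ≤ 1)
    (H : ∀ n a b c d a' b' c' d' : ℕ, W n a b c d → W n a' b' c' d' →
      ∀ᵐ x : ℝ × ℝ, 0 < x.1 → 0 < x.2 → f (act a b c d x) = f (act a' b' c' d' x)) : ∀ᵐ θ : ℝ, 0 < θ →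
    (∀ᵐ r : ℝ, 0 < r → f (r + r * θ, r * θ) = f (r, r * θ)) ∧
    (∀ᵐ r : ℝ, 0 < r → f (r, r * θ) = Phi f 1 θ) := by
  have hfL : Measurable fun x : ℝ × ℝ => f (x.1 + x.2, x.2) := by fun_prop
  have hbL : ∀ x : ℝ × ℝ, 0 ≤ f (x.1 + x.2, x.2) ∧ f (x.1 + x.2, x.2) ≤ 1 := fun x => hb _
  filter_upwards [stepA_all hf hb H] with θ hθ h0
  have hA := hθ h0
  have h1 : ∀ q : ℚ, 0 ≤ q → Phi (fun x => f (x.1 + x.2, x.2)) q θ = Phi f q θ := by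
    intro q hq
    simpa using hA q 0 hq le_rfl (by norm_num)
  have h2 : ∀ q t : ℚ, 0 ≤ q → 0 ≤ t → t ≤ 1 / 2 →
      Phi f ((1 + t) * q) θ = (1 + t) * Phi f q θ := by
    intro q t hq ht ht'
    have := hA q t hq ht ht'
    rw [h1 q hq] at this
    have ht0 : (0 : ℝ) ≤ t := by exact_mod_cast ht
    have : (1 + t : ℝ) ≠ 0 := by positivity
    field_simp at *
    linarith
  have h3 := hom_of_rat (φ := fun s => Phi f s θ) h2
  constructor
  · refine uniq (ray_li hfL hbL θ) (ray_li hf hb θ) fun s hs => ?_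
    exact ext_rat (Phi_cont hfL hbL θ) (Phi_cont hf hb θ) h1 s hs
  · refine uniq (v := fun _ => Phi f 1 θ) (ray_li hf hb θ) (locallyIntegrable_const _)
      fun s hs => ?_
    rw [intervalIntegral.integral_const, smul_eq_mul, sub_zero]
    exact ext_rat (v := fun s => s * Phi f 1 θ) (Phi_cont hf hb θ) (by fun_prop) h3 s hs

lemma inv_L {f : ℝ × ℝ → ℝ} (hf : Measurable f) (hb : ∀ x, 0 ≤ f x ∧ f x ≤ 1)
    (H : ∀ n a b c d a' b' c' d' : ℕ, W n a b c d → W n a' b' c' d' →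
      ∀ᵐ x : ℝ × ℝ, 0 < x.1 → 0 < x.2 → f (act a b c d x) = f (act a' b' c' d' x)) : ∀ᵐ x : ℝ × ℝ, 0 < x.1 → 0 < x.2 → f (x.1 + x.2, x.2) = f x := by
  refine coord_inv (P := fun x => f (x.1 + x.2, x.2) = f x)
    (measurableSet_eq_fun (by fun_prop) hf) ?_
  filter_upwards [homog hf hb H] with θ hθ h0 using (hθ h0).1

lemma slope_fun {f : ℝ × ℝ → ℝ} (hf : Measurable f) (hb : ∀ x, 0 ≤ f x ∧ f x ≤ 1)
    (H : ∀ n a b c d a' b' c' d' : ℕ, W n a b c d → W n a' b' c' d' →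
      ∀ᵐ x : ℝ × ℝ, 0 < x.1 → 0 < x.2 → f (act a b c d x) = f (act a' b' c' d' x)) : ∀ᵐ x : ℝ × ℝ, 0 < x.1 → 0 < x.2 → f x = Phi f 1 (x.2 / x.1) := by
  refine coord_inv (P := fun x => f x = Phi f 1 (x.2 / x.1))
    (measurableSet_eq_fun hf ((Phi_meas hf 1).comp (by fun_prop))) ?_
  filter_upwards [homog hf hb H] with θ hθ h0
  filter_upwards [(hθ h0).2] with r hr hr0
  rw [hr hr0]
  congr 1
  field_simp

lemma inv_pow {f : ℝ × ℝ → ℝ} (hf : Measurable f) (hb : ∀ x, 0 ≤ f x ∧ f x ≤ 1)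
    (H : ∀ n a b c d a' b' c' d' : ℕ, W n a b c d → W n a' b' c' d' →
      ∀ᵐ x : ℝ × ℝ, 0 < x.1 → 0 < x.2 → f (act a b c d x) = f (act a' b' c' d' x)) (n : ℕ) : ∀ᵐ x : ℝ × ℝ, 0 < x.1 → 0 < x.2 → f (act 1 n 0 1 x) = f x := by
  induction n with
  | zero => exact Eventually.of_forall fun x _ _ => by simp [act]
  | succ n ih =>
    filter_upwards [ih, (qmp_act 1 n 0 1 (by simp)).ae (inv_L hf hb H)] with x h1 h2 h3 h4
    rw [← h1 h3 h4, ← h2 (by simp only [act]; positivity) (by simp only [act]; linarith)]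
    congr 1
    simp only [act]; push_cast
    ext
    · simp only; ring
    · simp only

lemma inv_word {f : ℝ × ℝ → ℝ} (hf : Measurable f) (hb : ∀ x, 0 ≤ f x ∧ f x ≤ 1)
    (H : ∀ n a b c d a' b' c' d' : ℕ, W n a b c d → W n a' b' c' d' →
      ∀ᵐ x : ℝ × ℝ, 0 < x.1 → 0 < x.2 → f (act a b c d x) = f (act a' b' c' d' x)) {n a b c d : ℕ} (hw : W n a b c d) :
    ∀ᵐ φ : ℝ, 0 < φ → Phi f 1 ((c + d * φ) / (a + b * φ)) = Phi f 1 φ := by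
  have hdet := hw.detR
  have ha : (0 : ℝ) < a := by exact_mod_cast hw.det.2.1
  have hd : (0 : ℝ) < d := by exact_mod_cast hw.det.2.2
  have h1 := H n _ _ _ _ _ _ _ _ hw (W.powL n)
  have h2 : ∀ᵐ x : ℝ × ℝ, 0 < x.1 → 0 < x.2 →
      Phi f 1 ((c * x.1 + d * x.2) / (a * x.1 + b * x.2)) = Phi f 1 (x.2 / x.1) := by
    filter_upwards [h1, inv_pow hf hb H n, slope_fun hf hb H,
      (qmp_act a b c d (by linarith)).ae (slope_fun hf hb H)] with x g1 g2 g3 g4 p1 p2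
    have g4 := g4 (by simp only [act]; positivity) (by simp only [act]; positivity)
    rw [← g3 p1 p2, ← g2 p1 p2]
    have g1 := g1 p1 p2
    simp only [Nat.cast_one, Nat.cast_zero] at g1
    rw [← g1, g4]
    rfl
  filter_upwards [coord h2] with φ hφ h0
  by_contra hne
  have : ∀ᵐ r : ℝ, r ∉ Ioi (0 : ℝ) := by
    filter_upwards [hφ] with r hr hr0
    simp only [mem_Ioi] at hr0
    have h3 := hr hr0 hr0 (by positivity)
    apply hne
    rw [show r * φ / r = φ by field_simp] at h3
    rw [← h3]
    congr 1
    rw [show (c : ℝ) * r + d * (r * φ) = r * (c + d * φ) by ring,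
      show (a : ℝ) * r + b * (r * φ) = r * (a + b * φ) by ring,
      mul_div_mul_left _ _ hr0.ne']
  have := measure_eq_zero_iff_ae_notMem.mpr this
  simp at this

lemma stepB {f : ℝ × ℝ → ℝ} (hf : Measurable f) (hb : ∀ x, 0 ≤ f x ∧ f x ≤ 1)
    (H : ∀ n a b c d a' b' c' d' : ℕ, W n a b c d → W n a' b' c' d' →
      ∀ᵐ x : ℝ × ℝ, 0 < x.1 → 0 < x.2 → f (act a b c d x) = f (act a' b' c' d' x)) : ∃ κ : ℝ, ∀ᵐ φ : ℝ, 0 < φ → Phi f 1 φ = κ := by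
  set h := Phi f 1 with hh
  have hm : Measurable h := Phi_meas hf 1
  have hex : ∃ θ₀ : ℝ, 0 < θ₀ ∧ Irrational θ₀ ∧
      ∀ ε > 0, ∃ δ > 0, ∀ p q : ℝ, p < q → q - p < δ → p ≤ θ₀ → θ₀ ≤ q →
      ∫⁻ x in Icc p q, ENNReal.ofReal |h x - h θ₀| ≤ ENNReal.ofReal (ε * (q - p)) := by
    by_contra hne
    have : ∀ᵐ r : ℝ, r ∉ Ioi (0 : ℝ) := by
      filter_upwards [dens _ (Phi_li hf hb 1), ae_irrational] with r h1 h2 h3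
      exact hne ⟨r, h3, h2, h1⟩
    have := measure_eq_zero_iff_ae_notMem.mpr this
    simp at this
  obtain ⟨θ₀, h0, hirr, d1⟩ := hex
  refine ⟨h θ₀, ?_⟩
  have key : ∀ p : ℕ, ∫⁻ φ in Ioc (0 : ℝ) p, ENNReal.ofReal |h φ - h θ₀| = 0 := by
    intro p
    have claim : ∀ ε > 0, ∫⁻ φ in Ioc (0 : ℝ) p, ENNReal.ofReal |h φ - h θ₀|
        ≤ ENNReal.ofReal (2 * (1 + p) ^ 2 * ε) := by
      intro ε hε
      obtain ⟨δ, hδ, k1⟩ := d1 ε hε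
      obtain ⟨N, hN⟩ := exists_nat_gt (2 / δ)
      obtain ⟨n, a, b, c, d, hw, hNa, hba, hab, hc, hd⟩ := exists_word hirr h0 N
      have hdet := hw.detR
      have ha1 : (1 : ℝ) ≤ a := by exact_mod_cast hw.det.2.1
      have ha : (0 : ℝ) < a := by linarith
      have hba' : (b : ℝ) ≤ a := by exact_mod_cast hba
      have hab' : (a : ℝ) ≤ 2 * b := by exact_mod_cast hab
      have hsmall : 2 / (a : ℝ) ^ 2 < δ := by
        rw [div_lt_iff₀ hδ] at hN
        rw [div_lt_iff₀ (by positivity)]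
        have : (N : ℝ) ≤ a := by exact_mod_cast hNa
        nlinarith [mul_le_mul_of_nonneg_right this hδ.le,
          mul_le_mul_of_nonneg_left ha1 (mul_pos hδ ha).le]
      obtain ⟨w1, w2⟩ := word_size hdet ha hab hc hd
      have hpos : (0 : ℝ) < 2 / a ^ 2 := by positivity
      have K1 := k1 (c / a) (c / a + 2 / a ^ 2) (by linarith) (by linarith) w1 w2
      rw [add_sub_cancel_left] at K1
      have hcongr : ∫⁻ φ in Ioc (0 : ℝ) p, ENNReal.ofReal |h φ - h θ₀|
          = ∫⁻ φ in Ioc (0 : ℝ) p, ENNReal.ofReal |h ((c + d * φ) / (a + b * φ)) - h θ₀| := by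
        refine setLIntegral_congr_fun_ae measurableSet_Ioc ?_
        filter_upwards [inv_word hf hb H hw] with φ hφ hφ0
        rw [hh, hφ hφ0.1]
      rw [hcongr]
      refine cancel (m := 1 / (a * (1 + p)) ^ 2) (by positivity) ?_
      refine (pull (F := fun φ => (c + d * φ) / (a + b * φ)) (F' := fun φ => 1 / (a + b * φ) ^ 2)
        (J := Icc ((c : ℝ) / a) (c / a + 2 / a ^ 2)) (m := 1 / (a * (1 + p) : ℝ) ^ 2)
        measurableSet_Ioc ?_ ?_ ?_ ?_
        (fun x => ENNReal.ofReal |h x - h θ₀|)).trans (K1.trans_eq ?_)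
      · intro y hy
        have hy0 := hy.1
        have h3 : (a : ℝ) + b * y ≠ 0 := by positivity
        have := (((hasDerivAt_id y).const_mul (d : ℝ)).const_add (c : ℝ)).div
          (((hasDerivAt_id y).const_mul (b : ℝ)).const_add (a : ℝ)) h3
        refine HasDerivAt.congr_deriv this ?_
        simp only [id, mul_one]
        congr 1
        linear_combination hdet
      · intro y hy z hz hyz
        have hy0 := hy.1
        have hz0 := hz.1
        have h3 : (a : ℝ) + b * y ≠ 0 := by positivity
        have h4 : (a : ℝ) + b * z ≠ 0 := by positivity
        have hyz : ((c : ℝ) + d * y) / (a + b * y) = (c + d * z) / (a + b * z) := hyz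
        rw [div_eq_div_iff h3 h4] at hyz
        linear_combination hyz - (y - z) * hdet
      · intro y hy
        have hy0 := hy.1
        have h3 : (0 : ℝ) < (a : ℝ) + b * y := by positivity
        have e : ((c : ℝ) + d * y) / (a + b * y) = c / a + y / (a * (a + b * y)) := by
          field_simp
          linear_combination y * hdet
        simp only [e]
        refine ⟨by have : 0 ≤ y / (a * (a + b * y)) := by positivity
                   linarith, ?_⟩
        gcongr c / a + ?_
        rw [div_le_div_iff₀ (by positivity) (by positivity)]
        nlinarith [mul_le_mul_of_nonneg_left hab' (mul_pos ha hy0).le, mul_pos ha ha]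
      · intro y hy
        have hy0 := hy.1
        have : (a : ℝ) + b * y ≤ a * (1 + p) := by
          nlinarith [mul_le_mul hba' hy.2 hy0.le ha.le]
        gcongr
      · congr 1; field_simp
    by_contra hX
    set X := ∫⁻ φ in Ioc (0 : ℝ) p, ENNReal.ofReal |h φ - h θ₀|
    have hfin : X ≠ ⊤ := ((claim 1 one_pos).trans_lt ENNReal.ofReal_lt_top).ne
    have hXp : 0 < X.toReal := ENNReal.toReal_pos hX hfin
    have h4 := claim (X.toReal / (4 * (1 + p) ^ 2)) (by positivity)
    rw [show 2 * (1 + p : ℝ) ^ 2 * (X.toReal / (4 * (1 + p) ^ 2)) = X.toReal / 2 by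
      field_simp; norm_num] at h4
    have := ENNReal.toReal_le_of_le_ofReal (by positivity) h4
    linarith
  have key2 : ∀ p : ℕ, ∀ᵐ φ : ℝ, φ ∈ Ioc (0 : ℝ) p → h φ = h θ₀ := by
    intro p
    have := (lintegral_eq_zero_iff (by fun_prop)).mp (key p)
    have := (ae_restrict_iff' measurableSet_Ioc).mp this
    filter_upwards [this] with φ hφ hI
    have := hφ hI
    simp only [Pi.zero_apply, ENNReal.ofReal_eq_zero] at this
    exact sub_eq_zero.mp (abs_eq_zero.mp (le_antisymm this (abs_nonneg _)))
  filter_upwards [ae_all_iff.mpr key2] with φ hφ hpos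
  obtain ⟨p, hp⟩ := exists_nat_ge φ
  exact hφ p ⟨hpos, hp⟩

lemma conclusion {f : ℝ × ℝ → ℝ} (hf : Measurable f) (hb : ∀ x, 0 ≤ f x ∧ f x ≤ 1)
    (H : ∀ n a b c d a' b' c' d' : ℕ, W n a b c d → W n a' b' c' d' →
      ∀ᵐ x : ℝ × ℝ, 0 < x.1 → 0 < x.2 → f (act a b c d x) = f (act a' b' c' d' x)) : ∃ κ : ℝ, ∀ᵐ x : ℝ × ℝ, 0 < x.1 → 0 < x.2 → f x = κ := by
  obtain ⟨κ, hκ⟩ := stepB hf hb H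
  refine ⟨κ, coord_inv (P := fun x => f x = κ) (measurableSet_eq_fun hf measurable_const) ?_⟩
  filter_upwards [hκ, homog hf hb H] with θ h1 h2 h0
  filter_upwards [(h2 h0).2] with r hr hr0
  rw [hr hr0, h1 h0]

lemma ae_pos : ∀ᵐ x : ℝ × ℝ, x ∈ posQuad → 0 < x.1 ∧ 0 < x.2 := by
  have h1 : ∀ᵐ x : ℝ × ℝ, x.1 ≠ 0 :=
    Measure.quasiMeasurePreserving_fst.ae (Measure.ae_ne volume (0 : ℝ))
  have h2 : ∀ᵐ x : ℝ × ℝ, x.2 ≠ 0 :=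
    Measure.quasiMeasurePreserving_snd.ae (Measure.ae_ne volume (0 : ℝ))
  filter_upwards [h1, h2] with x h1 h2 h
  exact ⟨lt_of_le_of_ne h.1 h1.symm, lt_of_le_of_ne h.2 h2.symm⟩

end EuclidExact

open EuclidExact

/-- The homogeneous Euclidean algorithm is exact with respect to 2-dimensional Lebesgue
measure: if `A ⊆ ℝ₊²` is Lebesgue-measurable and for every `n` there is a
Lebesgue-measurable `Bₙ` with `λ(A Δ 𝓘⁻ⁿ(Bₙ)) = 0`, then `λ(A) = 0` or `λ(ℝ₊² ∖ A) = 0`. -/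
theorem euclidAlg_exact (A : Set (ℝ × ℝ)) (hA : NullMeasurableSet A volume)
    (hsub : A ⊆ posQuad)
    (h : ∀ n : ℕ, ∃ B : Set (ℝ × ℝ), NullMeasurableSet B volume ∧
      volume (symmDiff A {y ∈ posQuad | euclidAlg^[n] y ∈ B}) = 0) :
    volume A = 0 ∨ volume (posQuad \ A) = 0 := by
  
  obtain ⟨A', hAA', hA'm, hA'⟩ := hA.exists_measurable_superset_ae_eq
  have hA'' : ∀ᵐ x, x ∈ A' ↔ x ∈ A := hA'.mem_iff
  set f : ℝ × ℝ → ℝ := A'.indicator 1 with hfdef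
  have hf : Measurable f := measurable_one.indicator hA'm
  have hb : ∀ x, 0 ≤ f x ∧ f x ≤ 1 := by
    intro x
    by_cases hx : x ∈ A' <;> simp [hfdef, hx]
  have key : ∀ n : ℕ, ∃ B : Set (ℝ × ℝ), ∀ a b c d : ℕ, W n a b c d →
      ∀ᵐ x : ℝ × ℝ, 0 < x.1 → 0 < x.2 → (act a b c d x ∈ A' ↔ x ∈ B) := by
    intro n
    obtain ⟨B, _, hB⟩ := h n
    refine ⟨B, fun a b c d hw => ?_⟩
    have h1 : ∀ᵐ x, x ∈ A ↔ x ∈ {y ∈ posQuad | euclidAlg^[n] y ∈ B} :=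
      (measure_symmDiff_eq_zero_iff.mp hB).mem_iff
    have hq := qmp_act a b c d (by linarith [hw.detR])
    filter_upwards [hq.ae hA'', hq.ae h1] with x g1 g2 p1 p2
    rw [g1, g2]
    have hmem : act a b c d x ∈ posQuad :=
      ⟨by simp only [act]; positivity, by simp only [act]; positivity⟩
    have := hw.alg x p1 p2
    constructor
    · intro hx; rw [← this]; exact hx.2
    · intro hx; exact ⟨hmem, by rw [this]; exact hx⟩
  have H : ∀ n a b c d a' b' c' d' : ℕ, W n a b c d → W n a' b' c' d' →
      ∀ᵐ x : ℝ × ℝ, 0 < x.1 → 0 < x.2 → f (act a b c d x) = f (act a' b' c' d' x) := by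
    intro n a b c d a' b' c' d' hw hw'
    obtain ⟨B, hB⟩ := key n
    filter_upwards [hB _ _ _ _ hw, hB _ _ _ _ hw'] with x g1 g2 p1 p2
    have g := (g1 p1 p2).trans (g2 p1 p2).symm
    by_cases hx : act a b c d x ∈ A'
    · simp [hfdef, hx, g.mp hx]
    · simp [hfdef, hx, mt g.mpr hx]
  obtain ⟨κ, hκ⟩ := conclusion hf hb H
  by_cases h1 : κ = 1
  · right
    rw [measure_eq_zero_iff_ae_notMem]
    filter_upwards [hκ, ae_pos, hA''] with x g1 g2 g3 hx
    have p := g2 hx.1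
    have := g1 p.1 p.2
    have hn : x ∉ A' := fun hc => hx.2 (g3.mp hc)
    rw [h1] at this
    simp [hfdef, hn] at this
  · left
    rw [measure_eq_zero_iff_ae_notMem]
    filter_upwards [hκ, ae_pos] with x g1 g2 hx
    have p := g2 (hsub hx)
    have := g1 p.1 p.2
    simp [hfdef, hAA' hx] at this
    exact h1 this.symm
end

section
/- Let x = (x₁,x₂) ∈ ℝ₊² be such that x₁ and x₂ are linearly independent over ℚ. Then the full orbit of x under the homogeneous Euclidean algorithm equals the intersection of its SL(2,ℤ)-orbit with the positive cone: {y ∈ ℝ₊² : there exist k, l ∈ ℕ with 𝓘^l(y) = 𝓘^k(x)} = {A·x : A ∈ SL(2,ℤ)} ∩ ℝ₊². -/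
open MeasureTheory

/-- Strictly positive vectors with no integer relation. -/
def EGood (z : ℝ × ℝ) : Prop :=
  0 < z.1 ∧ 0 < z.2 ∧ ∀ a b : ℤ, (a : ℝ) * z.1 + (b : ℝ) * z.2 = 0 → a = 0 ∧ b = 0

theorem EGood.cases {z : ℝ × ℝ} (h : EGood z) :
    (z.2 < z.1 ∧ euclidAlg z = (z.1 - z.2, z.2)) ∨
      (z.1 < z.2 ∧ euclidAlg z = (z.1, z.2 - z.1)) := by
  obtain ⟨h1, h2, h3⟩ := h
  rcases lt_trichotomy z.1 z.2 with h | h | h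
  · right
    refine ⟨h, ?_⟩
    rw [euclidAlg, if_neg (not_le.mpr h)]
  · have := (h3 1 (-1) (by push_cast; linarith)).1
    omega
  · left
    refine ⟨h, ?_⟩
    rw [euclidAlg, if_pos h.le]

theorem EGood.step {z : ℝ × ℝ} (h : EGood z) : EGood (euclidAlg z) := by
  rcases h.cases with ⟨hl, he⟩ | ⟨hl, he⟩ <;> rw [he] <;> obtain ⟨h1, h2, h3⟩ := h
  · refine ⟨by simpa using hl, h2, fun a b hab => ?_⟩
    have := h3 a (b - a) (by push_cast; simp only at hab; linarith)
    omega
  · refine ⟨h1, by simpa using hl, fun a b hab => ?_⟩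
    have := h3 (a - b) b (by push_cast; simp only at hab; linarith)
    omega

theorem not_both_nonpos {z : ℝ × ℝ} (hz : EGood z) {p q : ℤ}
    (hpos : 0 < (p : ℝ) * z.1 + q * z.2) : ¬ (p ≤ 0 ∧ q ≤ 0) := by
  intro h0
  have hp : (p : ℝ) ≤ 0 := by exact_mod_cast h0.1
  have hq : (q : ℝ) ≤ 0 := by exact_mod_cast h0.2
  have := mul_nonpos_of_nonpos_of_nonneg hp hz.1.le
  have := mul_nonpos_of_nonpos_of_nonneg hq hz.2.1.le
  linarith

theorem row_descent (n : ℕ) : ∀ (z : ℝ × ℝ) (p q r s : ℤ), EGood z → p.natAbs + q.natAbs ≤ n →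
    0 < (p : ℝ) * z.1 + q * z.2 →
    ∃ (k : ℕ) (p' q' r' s' : ℤ), EGood (euclidAlg^[k] z) ∧ 0 ≤ p' ∧ 0 ≤ q' ∧
      (p' : ℝ) * (euclidAlg^[k] z).1 + q' * (euclidAlg^[k] z).2 = p * z.1 + q * z.2 ∧
      (r' : ℝ) * (euclidAlg^[k] z).1 + s' * (euclidAlg^[k] z).2 = r * z.1 + s * z.2 ∧
      p' * s' - q' * r' = p * s - q * r ∧ (0 ≤ r → 0 ≤ s → 0 ≤ r' ∧ 0 ≤ s') := by
  induction n with
  | zero =>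
    intro z p q r s hz hn hpos
    exact ⟨0, p, q, r, s, hz, by omega, by omega, rfl, rfl, rfl, fun a b => ⟨a, b⟩⟩
  | succ n ih =>
    intro z p q r s hz hn hpos
    by_cases hpq : 0 ≤ p ∧ 0 ≤ q
    · exact ⟨0, p, q, r, s, hz, hpq.1, hpq.2, rfl, rfl, rfl, fun a b => ⟨a, b⟩⟩
    have hmix : (p < 0 ∧ 0 < q) ∨ (0 < p ∧ q < 0) := by
      have := not_both_nonpos hz hpos
      omega
    have hg := hz.step
    rcases hz.cases with ⟨hl, he⟩ | ⟨hl, he⟩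
    · have e1 : ∀ a b : ℤ, (a : ℝ) * (euclidAlg z).1 + ((a + b : ℤ) : ℝ) * (euclidAlg z).2
          = a * z.1 + b * z.2 := by
        intro a b; rw [he]; push_cast; ring
      by_cases hnn : 0 ≤ p ∧ 0 ≤ p + q
      · exact ⟨1, p, p + q, r, r + s, hg, hnn.1, hnn.2, e1 p q, e1 r s, by ring,
          fun a b => ⟨a, by omega⟩⟩
      have hnp := not_both_nonpos hg (by rw [e1]; exact hpos)
      have hq0 : p.natAbs + (p + q).natAbs ≤ n := by omega
      obtain ⟨k, p', q', r', s', a1, a2, a3, a4, a5, a6, a7⟩ :=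
        ih (euclidAlg z) p (p + q) r (r + s) hg hq0 (by rw [e1]; exact hpos)
      rw [e1] at a4 a5
      refine ⟨k + 1, p', q', r', s', ?_⟩
      rw [Function.iterate_succ_apply]
      exact ⟨a1, a2, a3, a4, a5, by rw [a6]; ring, fun b c => a7 b (by omega)⟩
    · have e1 : ∀ a b : ℤ, ((a + b : ℤ) : ℝ) * (euclidAlg z).1 + (b : ℝ) * (euclidAlg z).2
          = a * z.1 + b * z.2 := by
        intro a b; rw [he]; push_cast; ring
      by_cases hnn : 0 ≤ p + q ∧ 0 ≤ q
      · exact ⟨1, p + q, q, r + s, s, hg, hnn.1, hnn.2, e1 p q, e1 r s, by ring,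
          fun a b => ⟨by omega, b⟩⟩
      have hnp := not_both_nonpos hg (by rw [e1]; exact hpos)
      have hq0 : (p + q).natAbs + q.natAbs ≤ n := by omega
      obtain ⟨k, p', q', r', s', a1, a2, a3, a4, a5, a6, a7⟩ :=
        ih (euclidAlg z) (p + q) q (r + s) s hg hq0 (by rw [e1]; exact hpos)
      rw [e1] at a4 a5
      refine ⟨k + 1, p', q', r', s', ?_⟩
      rw [Function.iterate_succ_apply]
      exact ⟨a1, a2, a3, a4, a5, by rw [a6]; ring, fun b c => a7 (by omega) c⟩

theorem nonneg_descent (z : ℝ × ℝ) (h1 : 0 < z.1) (h2 : 0 < z.2) (n : ℕ) :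
    ∀ p q r s : ℤ, 0 ≤ p → 0 ≤ q → 0 ≤ r → 0 ≤ s → p * s - q * r = 1 → p + q + r + s ≤ n →
    ∃ l : ℕ, euclidAlg^[l] ((p : ℝ) * z.1 + q * z.2, (r : ℝ) * z.1 + s * z.2) = z := by
  induction n with
  | zero =>
    intro p q r s hp hq hr hs hd hn
    have : p = 0 := by push_cast at hn; omega
    have : q = 0 := by push_cast at hn; omega
    subst p q
    omega
  | succ n ih =>
    intro p q r s hp hq hr hs hd hn
    push_cast at hn
    have hr1 : 0 < p + q := by
      by_contra hc
      have : p = 0 := by omega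
      have : q = 0 := by omega
      subst p q
      omega
    have hr2 : 0 < r + s := by
      by_contra hc
      have : r = 0 := by omega
      have : s = 0 := by omega
      subst r s
      omega
    by_cases hA : r ≤ p ∧ s ≤ q
    · obtain ⟨l, hl⟩ := ih (p - r) (q - s) r s (by omega) (by omega) hr hs (by linarith) (by omega)
      refine ⟨l + 1, ?_⟩
      rw [Function.iterate_succ_apply]
      refine Eq.trans (congrArg _ ?_) hl
      have c1 : (r : ℝ) ≤ p := by exact_mod_cast hA.1
      have c2 : (s : ℝ) ≤ q := by exact_mod_cast hA.2
      have := mul_le_mul_of_nonneg_right c1 h1.le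
      have := mul_le_mul_of_nonneg_right c2 h2.le
      rw [euclidAlg, if_pos (by simp only; linarith)]
      ext
      · push_cast; ring
      · rfl
    by_cases hB : p ≤ r ∧ q ≤ s
    · obtain ⟨l, hl⟩ := ih p q (r - p) (s - q) hp hq (by omega) (by omega) (by linarith) (by omega)
      refine ⟨l + 1, ?_⟩
      rw [Function.iterate_succ_apply]
      refine Eq.trans (congrArg _ ?_) hl
      have c1 : (p : ℝ) ≤ r := by exact_mod_cast hB.1
      have c2 : (q : ℝ) ≤ s := by exact_mod_cast hB.2
      have d1 := mul_le_mul_of_nonneg_right c1 h1.le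
      have d2 := mul_le_mul_of_nonneg_right c2 h2.le
      have hlt : (p : ℝ) * z.1 + q * z.2 < r * z.1 + s * z.2 := by
        rcases (show p < r ∨ q < s by omega) with h | h
        · have : (p : ℝ) < r := by exact_mod_cast h
          have := mul_lt_mul_of_pos_right this h1
          linarith
        · have : (q : ℝ) < s := by exact_mod_cast h
          have := mul_lt_mul_of_pos_right this h2
          linarith
      rw [euclidAlg, if_neg (by simp only; linarith)]
      ext
      · rfl
      · push_cast; ring
    rcases (show (r + 1 ≤ p ∧ q + 1 ≤ s) ∨ (p + 1 ≤ r ∧ s + 1 ≤ q) by omega) with ⟨ha, hb⟩ | ⟨ha, hb⟩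
    · have : r + q = 0 := by nlinarith
      have hr0 : r = 0 := by omega
      have hq0 : q = 0 := by omega
      subst hr0 hq0
      have hp1 : p = 1 := by nlinarith
      have hs1 : s = 1 := by nlinarith
      subst hp1 hs1
      exact ⟨0, by simp⟩
    · exfalso; nlinarith

theorem iterate_matrix (k : ℕ) : ∀ z : ℝ × ℝ, ∃ a b c d : ℤ, a * d - b * c = 1 ∧
    z.1 = a * (euclidAlg^[k] z).1 + b * (euclidAlg^[k] z).2 ∧
    z.2 = c * (euclidAlg^[k] z).1 + d * (euclidAlg^[k] z).2 := by
  induction k with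
  | zero => intro z; exact ⟨1, 0, 0, 1, by norm_num, by simp, by simp⟩
  | succ k ih =>
    intro z
    obtain ⟨a, b, c, d, h, h1, h2⟩ := ih (euclidAlg z)
    rw [Function.iterate_succ_apply]
    generalize euclidAlg^[k] (euclidAlg z) = w at *
    unfold euclidAlg at h1 h2
    split_ifs at h1 h2
    · refine ⟨a + c, b + d, c, d, by linarith, ?_, h2⟩
      simp only at h1 h2
      push_cast; linarith
    · refine ⟨a, b, a + c, b + d, by linarith, h1, ?_⟩
      simp only at h1 h2
      push_cast; linarith

/-- For `x ∈ ℝ₊²` with coordinates linearly independent over `ℚ`, the full orbit of `x`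
under the homogeneous Euclidean algorithm is the intersection of its `SL(2,ℤ)`-orbit with
the positive cone. -/
theorem euclidAlg_full_orbit (x : ℝ × ℝ) (hx : x ∈ posQuad)
    (hirr : LinearIndependent ℚ ![x.1, x.2]) :
    {y ∈ posQuad | ∃ k l : ℕ, euclidAlg^[l] y = euclidAlg^[k] x} =
      {y : ℝ × ℝ | ∃ A : Matrix (Fin 2) (Fin 2) ℤ, A.det = 1 ∧
        y.1 = (A 0 0 : ℝ) * x.1 + (A 0 1 : ℝ) * x.2 ∧
        y.2 = (A 1 0 : ℝ) * x.1 + (A 1 1 : ℝ) * x.2} ∩ posQuad := by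
  have hrel : ∀ a b : ℤ, (a : ℝ) * x.1 + (b : ℝ) * x.2 = 0 → a = 0 ∧ b = 0 := by
    intro a b hab
    have := LinearIndependent.pair_iff.mp hirr (a : ℚ) (b : ℚ)
      (by simpa [Rat.smul_def] using hab)
    exact_mod_cast this
  have hgood : EGood x := by
    refine ⟨lt_of_le_of_ne hx.1 fun h => ?_, lt_of_le_of_ne hx.2 fun h => ?_, hrel⟩
    · have := (hrel 1 0 (by rw [← h]; simp)).1
      omega
    · have := (hrel 0 1 (by rw [← h]; simp)).2
      omega
  ext y
  constructor
  · rintro ⟨hy, k, l, hkl⟩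
    refine ⟨?_, hy⟩
    obtain ⟨a, b, c, d, h, h1, h2⟩ := iterate_matrix l y
    obtain ⟨a', b', c', d', h', h1', h2'⟩ := iterate_matrix k x
    rw [hkl] at h1 h2
    generalize euclidAlg^[k] x = w at *
    have hr : (a' : ℝ) * d' - b' * c' = 1 := by exact_mod_cast h'
    have w1 : w.1 = d' * x.1 - b' * x.2 := by
      rw [h1', h2']; linear_combination (-w.1) * hr
    have w2 : w.2 = a' * x.2 - c' * x.1 := by
      rw [h1', h2']; linear_combination (-w.2) * hr
    refine ⟨!![a * d' - b * c', b * a' - a * b'; c * d' - d * c', d * a' - c * b'], ?_, ?_, ?_⟩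
    · rw [Matrix.det_fin_two_of]
      linear_combination (a' * d' - b' * c') * h + h'
    · simp only [Matrix.of_apply, Matrix.cons_val', Matrix.cons_val_zero, Matrix.cons_val_one]
      rw [h1, w1, w2]
      push_cast; ring
    · simp only [Matrix.of_apply, Matrix.cons_val', Matrix.cons_val_zero, Matrix.cons_val_one]
      rw [h2, w1, w2]
      push_cast; ring
  · rintro ⟨⟨A, hd, h1, h2⟩, hy⟩
    refine ⟨hy, ?_⟩
    rw [Matrix.det_fin_two] at hd
    generalize A 0 0 = p at *
    generalize A 0 1 = q at *
    generalize A 1 0 = r at *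
    generalize A 1 1 = s at *
    have y1 : 0 < (p : ℝ) * x.1 + q * x.2 := by
      refine lt_of_le_of_ne (h1 ▸ hy.1) fun h => ?_
      obtain ⟨rfl, rfl⟩ := hrel p q h.symm
      omega
    have y2 : 0 < (r : ℝ) * x.1 + s * x.2 := by
      refine lt_of_le_of_ne (h2 ▸ hy.2) fun h => ?_
      obtain ⟨rfl, rfl⟩ := hrel r s h.symm
      omega
    obtain ⟨k, p', q', r', s', a1, a2, a3, a4, a5, a6, -⟩ :=
      row_descent _ x p q r s hgood le_rfl y1
    obtain ⟨m, r'', s'', p'', q'', b1, b2, b3, b4, b5, b6, b7⟩ :=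
      row_descent _ _ r' s' p' q' a1 le_rfl (by rw [a5]; exact y2)
    obtain ⟨b8, b9⟩ := b7 a2 a3
    rw [← Function.iterate_add_apply] at b1 b4 b5
    obtain ⟨l, hl⟩ := nonneg_descent _ b1.1 b1.2.1 (p'' + q'' + r'' + s'').toNat p'' q'' r'' s''
      b8 b9 b2 b3 (by linarith) (by omega)
    refine ⟨m + k, l, ?_⟩
    rw [b4, b5, a4, a5, ← h1, ← h2] at hl
    exact hl
end

section
/- Let d ≥ 3 and let u, w ∈ Ω₁ satisfy u[1] = w[1]. Then for every index i with 2 ≤ i ≤ d one has w[i]/4 ≤ u[i] ≤ 4·w[i]. -/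
/-- The set `Ω₁ = {x ∈ ℝ^d : 0 ≤ x[1] ≤ x[2] ≤ … ≤ x[d] ≤ x[1]+x[2], x[1]+⋯+x[d] = 1}`,
for `d = m + 3`. -/
def selmerSimplex (m : ℕ) : Set (Fin (m + 3) → ℝ) :=
  {x | 0 ≤ x 0 ∧ Monotone x ∧ x (Fin.last (m + 2)) ≤ x 0 + x 1 ∧ ∑ i, x i = 1}

theorem selmer_aux (m : ℕ) (u w : Fin (m + 3) → ℝ)
    (hu : u ∈ selmerSimplex m) (hw : w ∈ selmerSimplex m) (h1 : u 0 = w 0)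
    (i : Fin (m + 3)) (hi : 1 ≤ (i : ℕ)) : u i ≤ 4 * w i := by
  obtain ⟨_, um, ul, us⟩ := hu
  obtain ⟨_, wm, wl, ws⟩ := hw
  have hone : ∀ j : Fin (m + 3), 1 ≤ (j : ℕ) → (1 : Fin (m + 3)) ≤ j := by
    intro j hj
    rw [Fin.le_def]
    simpa using hj
  rw [Fin.sum_univ_succ] at us ws
  have hlow : ∑ _j : Fin (m + 2), u 1 ≤ ∑ j : Fin (m + 2), u j.succ :=
    Finset.sum_le_sum fun j _ => um (hone _ (by simp))
  have hup : ∑ j : Fin (m + 2), w j.succ ≤ ∑ _j : Fin (m + 2), 2 * w 1 :=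
    Finset.sum_le_sum fun j _ => by
      have := wm (Fin.le_last j.succ)
      have := wm (Fin.zero_le (1 : Fin (m + 3)))
      linarith
  simp only [Finset.sum_const, Finset.card_univ, Fintype.card_fin, nsmul_eq_mul] at hlow hup
  have hpos : (0 : ℝ) < ((m + 2 : ℕ) : ℝ) := by positivity
  have key : u 1 ≤ 2 * w 1 := by
    refine le_of_mul_le_mul_left ?_ hpos
    linarith
  have a1 := um (Fin.le_last i)
  have a2 := um (Fin.zero_le (1 : Fin (m + 3)))
  have a3 := wm (hone i hi)
  linarith

/-- If `u, w ∈ Ω₁` have the same first coordinate, then all of their later coordinates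
agree up to a factor of `4`. -/
theorem selmer_jacobian_bound (m : ℕ) (u w : Fin (m + 3) → ℝ)
    (hu : u ∈ selmerSimplex m) (hw : w ∈ selmerSimplex m) (h1 : u 0 = w 0)
    (i : Fin (m + 3)) (hi : 1 ≤ (i : ℕ)) :
    w i / 4 ≤ u i ∧ u i ≤ 4 * w i := by
  have a := selmer_aux m u w hu hw h1 i hi
  have b := selmer_aux m w u hw hu h1.symm i hi
  exact ⟨by linarith, a⟩
end

section
/- Let d ≥ 3 and u ∈ Ω₁. Then u[d] ≤ 2/(d+1), and u[i] ≥ 1/(2d) for every index i with 2 ≤ i ≤ d. -/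
/-- For `u ∈ Ω₁`: `u[d] ≤ 2/(d+1)`, and `u[i] ≥ 1/(2d)` for every `2 ≤ i ≤ d`. -/
theorem selmer_entry_bounds (m : ℕ) (u : Fin (m + 3) → ℝ) (hu : u ∈ selmerSimplex m) :
    u (Fin.last (m + 2)) ≤ 2 / ((m : ℝ) + 4) ∧
      ∀ i : Fin (m + 3), 1 ≤ (i : ℕ) → 1 / (2 * ((m : ℝ) + 3)) ≤ u i := by
  obtain ⟨h0, hm, hl, hs⟩ := hu
  have h01 : u 0 ≤ u 1 := hm (Fin.zero_le _)
  have hb : u (Fin.last (m + 2)) / 2 ≤ u 1 := by linarith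
  have hmp : (0 : ℝ) ≤ m := Nat.cast_nonneg m
  constructor
  · rw [Fin.sum_univ_succ, Fin.sum_univ_succ, Fin.sum_univ_castSucc] at hs
    have hmid : ∑ _i : Fin m, u 1 ≤ ∑ i : Fin m, u i.castSucc.succ.succ := by
      refine Finset.sum_le_sum fun i _ => hm ?_
      rw [Fin.le_def]
      simp
    rw [Finset.sum_const, Finset.card_univ, Fintype.card_fin, nsmul_eq_mul] at hmid
    have e1 : u (Fin.succ 0) = u 1 := rfl
    have e2 : u (Fin.last m).succ.succ = u (Fin.last (m + 2)) := rfl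
    rw [e1, e2] at hs
    rw [le_div_iff₀ (by linarith)]
    nlinarith [mul_le_mul_of_nonneg_left hb hmp]
  · intro i hi
    have h1i : u 1 ≤ u i := hm (by rw [Fin.le_def]; simpa using hi)
    have hle : ∑ j, u j ≤ ∑ _j : Fin (m + 3), u (Fin.last (m + 2)) :=
      Finset.sum_le_sum fun j _ => hm (Fin.le_last j)
    rw [Finset.sum_const, Finset.card_univ, Fintype.card_fin, nsmul_eq_mul, hs] at hle
    push_cast at hle
    rw [div_le_iff₀ (by linarith)]
    have h2 : u (Fin.last (m + 2)) / 2 ≤ u i := hb.trans h1i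
    nlinarith [mul_le_mul_of_nonneg_left h2 (by linarith : (0 : ℝ) ≤ (m : ℝ) + 3)]
end

section
/- Let d ≥ 3 and let C[1],…,C[d] be positive reals with m = max{C[i] : 2 ≤ i ≤ d}. If u, w ∈ Ω₁ satisfy C[1]·u[1] ≤ m and C[1]·w[1] ≤ m, then C[1]u[1]+⋯+C[d]u[d] ≤ 4d·(C[1]w[1]+⋯+C[d]w[d]). -/
/-- Let `C[1],…,C[d] > 0` and let `mx = max{C[i] : 2 ≤ i ≤ d}`. If `u, w ∈ Ω₁` satisfy
`C[1]·u[1] ≤ mx` and `C[1]·w[1] ≤ mx`, then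
`C[1]u[1]+⋯+C[d]u[d] ≤ 4d·(C[1]w[1]+⋯+C[d]w[d])`. -/
theorem selmer_bounded_jacobian (m : ℕ) (C : Fin (m + 3) → ℝ) (hC : ∀ i, 0 < C i)
    (mx : ℝ) (hmx_ub : ∀ i : Fin (m + 3), 1 ≤ (i : ℕ) → C i ≤ mx)
    (hmx_mem : ∃ i : Fin (m + 3), 1 ≤ (i : ℕ) ∧ mx = C i)
    (u w : Fin (m + 3) → ℝ) (hu : u ∈ selmerSimplex m) (hw : w ∈ selmerSimplex m)
    (hu1 : C 0 * u 0 ≤ mx) (hw1 : C 0 * w 0 ≤ mx) :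
    (∑ i, C i * u i) ≤ 4 * ((m : ℝ) + 3) * ∑ i, C i * w i := by
  obtain ⟨hu0, hum, -, hus⟩ := hu
  obtain ⟨hw0, hwm, hwl, hws⟩ := hw
  obtain ⟨k, hk, rfl⟩ := hmx_mem
  have hCk := hC k
  have upos : ∀ i, 0 ≤ u i := fun i => hu0.trans (hum (Fin.zero_le i))
  have wpos : ∀ i, 0 ≤ w i := fun i => hw0.trans (hwm (Fin.zero_le i))
  have hup : (∑ i, C i * u i) ≤ 2 * C k := by
    rw [Fin.sum_univ_succ] at hus ⊢
    have h1 : ∑ i : Fin (m + 2), C i.succ * u i.succ ≤ C k * ∑ i : Fin (m + 2), u i.succ := by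
      rw [Finset.mul_sum]
      exact Finset.sum_le_sum fun i _ =>
        mul_le_mul_of_nonneg_right (hmx_ub _ (by simp)) (upos _)
    have h2 : C k * ∑ i : Fin (m + 2), u i.succ ≤ C k * 1 :=
      mul_le_mul_of_nonneg_left (by linarith) hCk.le
    linarith
  have hk1 : w 1 ≤ w k := hwm (by
    rw [Fin.le_def]
    simpa using hk)
  have h01 : w 0 ≤ w 1 := hwm (Fin.zero_le 1)
  have hone : 1 ≤ ((m : ℝ) + 3) * (2 * w k) := by
    rw [← hws]
    have h := Finset.sum_le_card_nsmul Finset.univ w (2 * w k) (fun i _ => by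
      have := hwm (Fin.le_last i)
      linarith)
    simpa using h
  have hlow : C k * w k ≤ ∑ i, C i * w i :=
    Finset.single_le_sum (f := fun i => C i * w i)
      (fun i _ => mul_nonneg (hC i).le (wpos i)) (Finset.mem_univ k)
  have hm : (0 : ℝ) ≤ 4 * ((m : ℝ) + 3) := by positivity
  have h3 := mul_le_mul_of_nonneg_left hlow hm
  have h4 := mul_le_mul_of_nonneg_left hone hCk.le
  nlinarith
end

section
/- Let d ≥ 3. There exists a constant r > 0, depending only on d, such that for every ε ∈ (0,1] and every s ∈ (0, 1/d]: λ₀({v ∈ Ω₁ : v[1] ≤ ε·s}) ≤ r·ε^{d−1}·λ₀({v ∈ Ω₁ : v[1] ≤ s}). -/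
open MeasureTheory

/-- The set `Ω₁ = {x ∈ ℝ^d : 0 ≤ x[1] ≤ x[2] ≤ … ≤ x[d] ≤ x[1]+x[2], x[1]+⋯+x[d] = 1}`,
for `d = m + 3`, inside Euclidean space. -/
def selmerSimplexE (m : ℕ) : Set (EuclideanSpace ℝ (Fin (m + 3))) :=
  {x | 0 ≤ x 0 ∧ (∀ i j : Fin (m + 3), i ≤ j → x i ≤ x j) ∧
    x (Fin.last (m + 2)) ≤ x 0 + x 1 ∧ ∑ i, x i = 1}

lemma selmer_aux_subset (m : ℕ) (ε s : ℝ) (hε : 0 < ε) (hs' : s ≤ 1 / (2 * ((m : ℝ) + 2)))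
    (p : EuclideanSpace ℝ (Fin (m + 3)))
    (hp0 : p 0 = 0) (hp : ∀ i : Fin (m + 2), p i.succ = 1 / ((m : ℝ) + 2)) :
    {v ∈ selmerSimplexE m | v 0 ≤ ε * s} ⊆
      Set.image (AffineMap.homothety p ε) {v ∈ selmerSimplexE m | v 0 ≤ s} := by
  rintro x ⟨⟨h0, hmono, hlast, hsum⟩, hxs⟩
  have hm : (0 : ℝ) < (m : ℝ) + 2 := by positivity
  set y : EuclideanSpace ℝ (Fin (m + 3)) := AffineMap.homothety p ε⁻¹ x with hy
  have hyi : ∀ i, y i = ε⁻¹ * (x i - p i) + p i := by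
    intro i
    simp [hy, AffineMap.homothety_apply]
  have hei : 0 < ε⁻¹ := inv_pos.mpr hε
  have hy0 : y 0 = ε⁻¹ * x 0 := by rw [hyi, hp0]; ring
  have hys : y 0 ≤ s := by
    rw [hy0, inv_mul_le_iff₀ hε]; exact hxs
  have hy00 : 0 ≤ y 0 := by rw [hy0]; positivity
  have hmono' : ∀ i j : Fin (m + 2), i ≤ j → y i.succ ≤ y j.succ := by
    intro i j hij
    rw [hyi, hyi, hp, hp]
    have := hmono i.succ j.succ (Fin.succ_le_succ_iff.mpr hij)
    gcongr
  have hylast : y (Fin.last (m + 2)) ≤ y 0 + y 1 := by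
    have e1 : p (Fin.last (m + 2)) = 1 / ((m : ℝ) + 2) := by
      rw [← Fin.succ_last]; exact hp _
    have e2 : p 1 = 1 / ((m : ℝ) + 2) := hp 0
    rw [hy0, hyi, hyi 1, e1, e2]
    have := mul_le_mul_of_nonneg_left hlast hei.le
    linarith
  have hpsum : ∑ i, p i = 1 := by
    rw [Fin.sum_univ_succ, hp0]
    simp only [hp, Finset.sum_const, Finset.card_univ, Fintype.card_fin, nsmul_eq_mul]
    push_cast
    field_simp
    ring
  have hysum : ∑ i, y i = 1 := by
    simp only [hyi]
    rw [Finset.sum_add_distrib, ← Finset.mul_sum, Finset.sum_sub_distrib, hsum, hpsum]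
    ring
  have hle : ∀ i : Fin (m + 2), y i.succ ≤ y 0 + y 1 := by
    intro i
    refine le_trans (hmono' i (Fin.last _) (Fin.le_last _)) ?_
    rw [Fin.succ_last]; exact hylast
  have hkey : y 0 ≤ y 1 := by
    have h1 : ∑ i : Fin (m + 2), y i.succ ≤ y 1 + ((m : ℝ) + 1) * (y 0 + y 1) := by
      rw [Fin.sum_univ_succ]
      have : ∑ i : Fin (m + 1), y i.succ.succ ≤ ∑ i : Fin (m + 1), (y 0 + y 1) :=
        Finset.sum_le_sum fun i _ => hle _
      simp only [Finset.sum_const, Finset.card_univ, Fintype.card_fin, nsmul_eq_mul] at this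
      push_cast at this
      have e : y (Fin.succ 0) = y 1 := rfl
      linarith
    rw [Fin.sum_univ_succ] at hysum
    have h2 : 1 ≤ ((m : ℝ) + 2) * (y 0 + y 1) := by linarith
    have h3 : s * (2 * ((m : ℝ) + 2)) ≤ 1 := by
      rwa [le_div_iff₀ (by positivity)] at hs'
    have h4 : y 0 * (2 * ((m : ℝ) + 2)) ≤ s * (2 * ((m : ℝ) + 2)) := by gcongr
    by_contra hc
    push Not at hc
    nlinarith
  refine ⟨y, ⟨⟨hy00, ?_, hylast, hysum⟩, hys⟩, ?_⟩
  · intro i j hij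
    induction i using Fin.cases with
    | zero =>
      induction j using Fin.cases with
      | zero => exact le_rfl
      | succ j => exact hkey.trans (hmono' 0 j (Fin.zero_le _))
    | succ i =>
      induction j using Fin.cases with
      | zero => simp at hij
      | succ j => exact hmono' i j (Fin.succ_le_succ_iff.mp hij)
  · ext i
    have : (AffineMap.homothety p ε y) i = ε * (y i - p i) + p i := by
      simp [AffineMap.homothety_apply]
    rw [this, hyi]
    field_simp
    ring

lemma selmer_aux_measure (m : ℕ) (ε s : ℝ) (hε : 0 < ε) (hs' : s ≤ 1 / (2 * ((m : ℝ) + 2))) :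
    μH[(m + 2 : ℝ)] {v ∈ selmerSimplexE m | v 0 ≤ ε * s} ≤
        ENNReal.ofReal (ε ^ (m + 2)) *
          μH[(m + 2 : ℝ)] {v ∈ selmerSimplexE m | v 0 ≤ s} := by
  have h := measure_mono (μ := μH[(m + 2 : ℝ)]) (selmer_aux_subset m ε s hε hs'
    (WithLp.toLp 2 (Fin.cons 0 fun _ => 1 / ((m : ℝ) + 2))) (by simp) (by simp))
  refine h.trans (le_of_eq ?_)
  rw [hausdorffMeasure_homothety_image (by positivity) _ hε.ne', ENNReal.smul_def, smul_eq_mul]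
  congr 1
  rw [ENNReal.ofReal, ENNReal.coe_inj]
  ext
  rw [Real.coe_toNNReal _ (by positivity)]
  push_cast
  rw [Real.norm_of_nonneg hε.le, ← Real.rpow_natCast]
  push_cast
  rfl

theorem selmer_small_measure (m : ℕ) :
    ∃ r : ℝ, 0 < r ∧ ∀ ε : ℝ, 0 < ε → ε ≤ 1 → ∀ s : ℝ, 0 < s → s ≤ 1 / ((m : ℝ) + 3) →
      μH[(m + 2 : ℝ)] {v ∈ selmerSimplexE m | v 0 ≤ ε * s} ≤
        ENNReal.ofReal (r * ε ^ (m + 2)) *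
          μH[(m + 2 : ℝ)] {v ∈ selmerSimplexE m | v 0 ≤ s} := by
  refine ⟨2 ^ (m + 2), by positivity, fun ε hε hε1 s hs hs1 => ?_⟩
  rw [← mul_pow]
  by_cases h : 2 * ε ≤ 1
  · have hs2 : s / 2 ≤ 1 / (2 * ((m : ℝ) + 2)) := by
      have : 1 / ((m : ℝ) + 3) ≤ 1 / ((m : ℝ) + 2) := by gcongr; norm_num
      rw [mul_comm, ← div_div]
      linarith
    have := selmer_aux_measure m (2 * ε) (s / 2) (by positivity) hs2
    rw [show 2 * ε * (s / 2) = ε * s by ring] at this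
    refine this.trans ?_
    gcongr
    linarith
  · push Not at h
    have h1 : (1 : ENNReal) ≤ ENNReal.ofReal ((2 * ε) ^ (m + 2)) := by
      rw [ENNReal.one_le_ofReal]
      exact one_le_pow₀ h.le
    calc _ ≤ μH[(m + 2 : ℝ)] {v ∈ selmerSimplexE m | v 0 ≤ s} := by
          apply measure_mono
          rintro x ⟨hx, hx'⟩
          exact ⟨hx, hx'.trans (by nlinarith)⟩
      _ ≤ _ := le_mul_of_one_le_left zero_le h1
end

section
/- Let d ≥ 3. There exists a constant r ∈ (0,1), depending only on d, such that for all positive reals C[1],…,C[d]: ∫_{{v ∈ Ω₁ : v[d] > v[1]+v[2]−r·v[1]}} (C[1]v[1]+⋯+C[d]v[d])^{−d} dλ₀(v) < (1/2)·∫_{Ω₁} (C[1]v[1]+⋯+C[d]v[d])^{−d} dλ₀(v). -/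
open MeasureTheory

open scoped ENNReal NNReal

/-- `w j = x j - x 1` for `j ≥ 2`, and `0` for `j = 0, 1`. -/
def selW (m : ℕ) (x : EuclideanSpace ℝ (Fin (m + 3))) (j : Fin (m + 3)) : ℝ :=
  if j ≤ 1 then 0 else x j - x 1

lemma selW_add (m : ℕ) (x y : EuclideanSpace ℝ (Fin (m + 3))) (j : Fin (m + 3)) :
    selW m (x + y) j = selW m x j + selW m y j := by
  unfold selW; split_ifs <;> simp; ring

lemma selW_smul (m : ℕ) (a : ℝ) (x : EuclideanSpace ℝ (Fin (m + 3))) (j : Fin (m + 3)) :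
    selW m (a • x) j = a * selW m x j := by
  unfold selW; split_ifs <;> simp; ring

noncomputable def selDlin (m : ℕ) :
    EuclideanSpace ℝ (Fin (m + 3)) →ₗ[ℝ] EuclideanSpace ℝ (Fin (m + 3)) where
  toFun x := WithLp.toLp 2 (fun j => - selW m x j + (∑ i, selW m x i) / (m + 3))
  map_add' x y := by
    ext j
    simp only [selW_add, Finset.sum_add_distrib, PiLp.add_apply]
    ring
  map_smul' a x := by
    ext j
    simp only [selW_smul, ← Finset.mul_sum, PiLp.smul_apply, smul_eq_mul, RingHom.id_apply]
    ring

noncomputable def selD (m : ℕ) :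
    EuclideanSpace ℝ (Fin (m + 3)) →L[ℝ] EuclideanSpace ℝ (Fin (m + 3)) :=
  (selDlin m).toContinuousLinearMap

lemma selD_apply (m : ℕ) (x : EuclideanSpace ℝ (Fin (m + 3))) (j : Fin (m + 3)) :
    selD m x j = - selW m x j + (∑ i, selW m x i) / (m + 3) := rfl

lemma selW_D (m : ℕ) (x : EuclideanSpace ℝ (Fin (m + 3))) (j : Fin (m + 3)) :
    selW m (selD m x) j = - selW m x j := by
  have h1 : selW m x 1 = 0 := by simp [selW]
  rw [selW, selD_apply, selD_apply, h1]
  split_ifs with h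
  · simp [selW, h]
  · ring

lemma selD_D (m : ℕ) (x : EuclideanSpace ℝ (Fin (m + 3))) :
    selD m (selD m x) = - selD m x := by
  ext j
  rw [selD_apply, PiLp.neg_apply, selD_apply]
  simp only [selW_D, Finset.sum_neg_distrib]
  ring

noncomputable def selL (m : ℕ) (u : ℝ) :
    EuclideanSpace ℝ (Fin (m + 3)) →L[ℝ] EuclideanSpace ℝ (Fin (m + 3)) :=
  ContinuousLinearMap.id ℝ _ + u • selD m

lemma selL_apply (m : ℕ) (u : ℝ) (x : EuclideanSpace ℝ (Fin (m + 3))) :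
    selL m u x = x + u • selD m x := rfl

lemma selL_comp (m : ℕ) (u v : ℝ) (h : u + v = u * v) (x : EuclideanSpace ℝ (Fin (m + 3))) :
    selL m u (selL m v x) = x := by
  simp only [selL_apply, map_add, map_smul, selD_D, smul_add, smul_neg, smul_smul]
  have : u • selD m x = (u * v - v) • selD m x := by congr 1; linarith
  rw [this, sub_smul, mul_comm v u]
  abel

lemma selL_norm (m : ℕ) (u : ℝ) (hu : |u| ≤ 1) : ‖selL m u‖₊ ≤ 1 + ‖selD m‖₊ := by
  rw [← NNReal.coe_le_coe]
  push_cast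
  refine (norm_add_le _ _).trans ?_
  gcongr
  · exact ContinuousLinearMap.norm_id_le
  · rw [norm_smul, Real.norm_eq_abs]
    nlinarith [norm_nonneg (selD m)]

set_option maxHeartbeats 1000000 in
/-- The map `L_t` maps `B` into `Ω₁`, with quantitative information. -/
lemma selL_mem (m : ℕ) (t r : ℝ) (ht : 0 < t) (ht2 : t ≤ 1 / 16) (hr : 0 < r) (hrt : r ≤ t)
    (v : EuclideanSpace ℝ (Fin (m + 3))) (hv : v ∈ selmerSimplexE m)
    (hB : v 0 + v 1 - r * v 0 < v (Fin.last (m + 2))) :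
    selL m t v ∈ selmerSimplexE m ∧
    0 < selL m t v (Fin.last (m + 2)) - selL m t v 1 ∧
    t * (selL m t v (Fin.last (m + 2)) - selL m t v 1) ≤
      selL m t v 0 + selL m t v 1 - selL m t v (Fin.last (m + 2)) ∧
    selL m t v 0 + selL m t v 1 - selL m t v (Fin.last (m + 2)) <
      8 * t * (selL m t v (Fin.last (m + 2)) - selL m t v 1) ∧
    ∀ C : Fin (m + 3) → ℝ, (∀ i, 0 < C i) →
      ∑ i, C i * selL m t v i ≤ 2 * ∑ i, C i * v i := by
  obtain ⟨h0, hmono, hlast, hsum⟩ := hv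
  set c : ℝ := t * ((∑ i, selW m v i) / (m + 3)) with hc
  have hL : ∀ j, selL m t v j = v j - t * selW m v j + c := by
    intro j
    rw [selL_apply, PiLp.add_apply, PiLp.smul_apply, selD_apply, smul_eq_mul, hc]; ring
  set σ : ℝ := v (Fin.last (m + 2)) - v 1 with hσ
  have h01 : v 0 ≤ v 1 := hmono 0 1 (Fin.zero_le _)
  have hw0 : ∀ j, 0 ≤ selW m v j := by
    intro j; unfold selW; split_ifs with h
    · exact le_rfl
    · have := hmono 1 j (le_of_lt (not_le.mp h)); linarith
  have hσ0 : 0 ≤ σ := by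
    have := hmono 1 (Fin.last _) (Fin.le_last _); linarith
  have hwσ : ∀ j, selW m v j ≤ σ := by
    intro j; unfold selW; split_ifs with h
    · exact hσ0
    · have := hmono j (Fin.last _) (Fin.le_last _); linarith
  have hS0 : 0 ≤ ∑ i, selW m v i := Finset.sum_nonneg fun i _ => hw0 i
  have hSσ : (∑ i, selW m v i) / (m + 3) ≤ σ := by
    rw [div_le_iff₀ (by positivity)]
    calc ∑ i, selW m v i ≤ ∑ i : Fin (m + 3), σ := Finset.sum_le_sum fun i _ => hwσ i
      _ = σ * (m + 3) := by simp; ring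
  have hc0 : 0 ≤ c := by positivity
  have hcσ : c ≤ t * σ := by rw [hc]; gcongr
  have hσpos : 0 < σ := by
    rcases hσ0.lt_or_eq with h | h
    · exact h
    · exfalso
      have : v 0 * (1 - r) < 0 := by nlinarith
      nlinarith
  have w0 : selW m v 0 = 0 := by simp [selW]
  have w1 : selW m v 1 = 0 := by simp [selW]
  have wl : selW m v (Fin.last (m + 2)) = σ := by
    have : ¬ (Fin.last (m + 2) ≤ (1 : Fin (m + 3))) := by
      rw [Fin.le_def]; simp
    simp [selW, this, hσ]
  have hL0 := hL 0
  have hL1 := hL 1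
  have hLl := hL (Fin.last (m + 2))
  rw [w0] at hL0
  rw [w1] at hL1
  rw [wl] at hLl
  have hσx : σ ≤ v 0 := by linarith
  have hy : v 0 * (1 - r) < σ := by linarith
  have hy2 : v 0 - σ < 2 * r * σ := by nlinarith
  have htσ : t * σ ≤ σ / 16 := by nlinarith
  have htσ0 : 0 < t * σ := by positivity
  have hrσ : r * σ ≤ t * σ := by gcongr
  have httσ : t * (t * σ) ≤ (t * σ) / 16 := by nlinarith
  have httσ0 : 0 < t * (t * σ) := by positivity
  refine ⟨⟨?_, ?_, ?_, ?_⟩, ?_, ?_, ?_, ?_⟩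
  · rw [hL0]; linarith
  · intro i j hij
    rw [hL, hL]
    have := hmono i j hij
    unfold selW
    split_ifs with h1 h2 h2
    · linarith
    · have a1 := hmono i 1 h1
      have a2 := hmono 1 j (le_of_lt (not_le.mp h2))
      nlinarith
    · exact absurd (hij.trans h2) h1
    · nlinarith
  · rw [hL0, hL1, hLl]; linarith
  · simp only [hL, Finset.sum_add_distrib, Finset.sum_sub_distrib, ← Finset.mul_sum, hsum]
    simp only [Finset.sum_const, Finset.card_univ, Fintype.card_fin, nsmul_eq_mul]
    push_cast
    have key : ((m : ℝ) + 3) * c = t * ∑ i, selW m v i := by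
      rw [hc]
      generalize (∑ i, selW m v i) = W
      have h3 : ((m : ℝ) + 3) ≠ 0 := by positivity
      field_simp
    linarith
  · rw [hL1, hLl]; linarith
  · rw [hL0, hL1, hLl]; nlinarith
  · rw [hL0, hL1, hLl]; nlinarith
  · intro C hC
    rw [Finset.mul_sum]
    refine Finset.sum_le_sum fun i _ => ?_
    have a1 := hmono 0 i (Fin.zero_le _)
    have a2 : selL m t v i ≤ 2 * v i := by
      rw [hL]; nlinarith [mul_nonneg ht.le (hw0 i)]
    nlinarith [hC i]

lemma sel_lipschitz_le (m : ℕ) (u : ℝ) (hu : |u| ≤ 1) (E : Set (EuclideanSpace ℝ (Fin (m + 3)))) :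
    μH[(m + 2 : ℝ)] (selL m u '' E) ≤
      ((1 + ‖selD m‖₊ : ℝ≥0) : ℝ≥0∞) ^ (m + 2 : ℝ) * μH[(m + 2 : ℝ)] E :=
  (((selL m u).lipschitz.weaken (selL_norm m u hu)).hausdorffMeasure_image_le
    (by positivity) E)

lemma selSimplex_closed (m : ℕ) : IsClosed (selmerSimplexE m) := by
  have : selmerSimplexE m = {x | 0 ≤ x 0} ∩ ((⋂ i, ⋂ j, ⋂ (_ : i ≤ j), {x | x i ≤ x j}) ∩
    ({x | x (Fin.last (m + 2)) ≤ x 0 + x 1} ∩ {x | ∑ i, x i = 1})) := by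
    ext x; simp [selmerSimplexE]
  rw [this]
  refine (isClosed_le (by fun_prop) (by fun_prop)).inter (IsClosed.inter ?_ (IsClosed.inter ?_ ?_))
  · exact isClosed_iInter fun i => isClosed_iInter fun j => isClosed_iInter fun _ =>
      isClosed_le (by fun_prop) (by fun_prop)
  · exact isClosed_le (by fun_prop) (by fun_prop)
  · exact isClosed_eq (by fun_prop) (by fun_prop)

lemma sel_pi (m : ℕ) : (μH[(m + 2 : ℝ)] : Measure (Fin (m + 2) → ℝ)) = volume := by
  have := hausdorffMeasure_pi_real (ι := Fin (m + 2))
  rw [← this]; simp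

noncomputable def selA (m : ℕ) :
    (Fin (m + 2) → ℝ) →ₗ[ℝ] EuclideanSpace ℝ (Fin (m + 3)) where
  toFun z := WithLp.toLp 2 (Fin.cons (- ∑ i, z i) z)
  map_add' x y := by
    ext j
    refine Fin.cases ?_ (fun i => ?_) j
    · simp [Finset.sum_add_distrib]; ring
    · simp
  map_smul' a x := by
    ext j
    refine Fin.cases ?_ (fun i => ?_) j
    · simp [Finset.mul_sum]
    · simp

lemma selSimplex_lt_top (m : ℕ) : μH[(m + 2 : ℝ)] (selmerSimplexE m) < ⊤ := by
  set A := (selA m).toContinuousLinearMap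
  set b : EuclideanSpace ℝ (Fin (m + 3)) := EuclideanSpace.single 0 1
  have hlip : LipschitzWith ‖A‖₊ (fun z => A z + b) := by
    simpa using A.lipschitz.add (LipschitzWith.const b)
  have hsub : selmerSimplexE m ⊆ (fun z => A z + b) '' (Set.Icc 0 1) := by
    rintro x ⟨h0, hmono, -, hsum⟩
    have hx : ∀ i, 0 ≤ x i := fun i => h0.trans (hmono 0 i (Fin.zero_le _))
    refine ⟨fun i => x i.succ, ⟨fun i => hx _, fun i => ?_⟩, ?_⟩
    · show x i.succ ≤ 1
      rw [← hsum]
      exact Finset.single_le_sum (f := fun i => x i) (fun i _ => hx i) (Finset.mem_univ _)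
    · ext j
      rw [Fin.sum_univ_succ] at hsum
      show (Fin.cons (- ∑ i : Fin (m + 2), x i.succ) (fun i : Fin (m + 2) => x i.succ) :
        Fin (m + 3) → ℝ) j + b j = x j
      refine Fin.cases ?_ (fun i => ?_) j
      · simp [b]; linarith
      · simp [b]
  refine (measure_mono hsub).trans_lt ?_
  refine (hlip.hausdorffMeasure_image_le (by positivity) _).trans_lt ?_
  rw [sel_pi]
  refine ENNReal.mul_lt_top (ENNReal.rpow_lt_top_of_nonneg (by positivity) (by simp)) ?_
  exact isCompact_Icc.measure_lt_top

lemma selSimplex_pos (m : ℕ) : 0 < μH[(m + 2 : ℝ)] (selmerSimplexE m) := by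
  set p : EuclideanSpace ℝ (Fin (m + 3)) → (Fin (m + 2) → ℝ) := fun x i => x i.succ
  have hp : LipschitzWith 1 p := by
    refine LipschitzWith.of_dist_le_mul fun x y => ?_
    rw [NNReal.coe_one, one_mul, dist_pi_le_iff dist_nonneg]
    intro i
    rw [dist_eq_norm, dist_eq_norm]
    exact PiLp.norm_apply_le (x - y) i.succ
  set U : Set (Fin (m + 2) → ℝ) := {z | 0 < 1 - ∑ i, z i} ∩ ({z | 1 - ∑ i, z i < z 0} ∩
    ((⋂ i, ⋂ j, ⋂ (_ : i < j), {z | z i < z j}) ∩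
    {z | z (Fin.last (m + 1)) < 1 - ∑ i, z i + z 0})) with hU
  have hUo : IsOpen U := by
    refine (isOpen_lt (by fun_prop) (by fun_prop)).inter ((isOpen_lt (by fun_prop)
      (by fun_prop)).inter (IsOpen.inter ?_ (isOpen_lt (by fun_prop) (by fun_prop))))
    exact isOpen_iInter_of_finite fun i => isOpen_iInter_of_finite fun j =>
      isOpen_iInter_of_finite fun _ => isOpen_lt (by fun_prop) (by fun_prop)
  have hUn : U.Nonempty := by
    set S : ℝ := ∑ i : Fin (m + 3), ((m : ℝ) + 3 + (i : ℕ)) with hS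
    have hSpos : 0 < S := Finset.sum_pos (fun i _ => by positivity) ⟨0, Finset.mem_univ _⟩
    have hS' : S = (m + 3) + ∑ i : Fin (m + 2), ((m : ℝ) + 4 + (i : ℕ)) := by
      rw [hS, Fin.sum_univ_succ]
      congr 1
      · simp
      · refine Finset.sum_congr rfl fun i _ => ?_
        simp; ring
    set z : Fin (m + 2) → ℝ := fun i => ((m : ℝ) + 4 + (i : ℕ)) / S with hz
    have hx0 : 1 - ∑ i, z i = (m + 3) / S := by
      rw [hz, ← Finset.sum_div]
      field_simp
      linarith
    refine ⟨z, ?_, ?_, ?_, ?_⟩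
    · simp only [Set.mem_ofPred_eq, hx0]; positivity
    · rw [Set.mem_ofPred_eq, hx0]
      simp only [hz]
      refine div_lt_div_of_pos_right ?_ hSpos
      rw [Fin.val_zero]
      push_cast
      linarith
    · simp only [Set.mem_iInter, Set.mem_ofPred_eq, hz]
      intro i j hij
      gcongr
      exact hij
    · rw [Set.mem_ofPred_eq, hx0]
      simp only [hz, ← add_div]
      refine div_lt_div_of_pos_right ?_ hSpos
      rw [Fin.val_zero, Fin.val_last]
      push_cast
      linarith
  have hsub : U ⊆ p '' selmerSimplexE m := by
    rintro z ⟨h1, h2, h3, h4⟩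
    simp only [Set.mem_iInter, Set.mem_ofPred_eq] at h1 h2 h3 h4
    have hm : ∀ i j, i ≤ j → z i ≤ z j := by
      intro i j hij
      rcases hij.lt_or_eq with h | h
      · exact (h3 i j h).le
      · rw [h]
    refine ⟨WithLp.toLp 2 (Fin.cons (1 - ∑ i, z i) z), ⟨?_, ?_, ?_, ?_⟩, ?_⟩
    · simpa using h1.le
    · intro i j
      refine Fin.cases ?_ (fun i => ?_) i <;> refine Fin.cases ?_ (fun j => ?_) j
      · simp
      · intro _
        have := hm 0 j (Fin.zero_le _)
        simp only [Fin.cons_zero, Fin.cons_succ]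
        linarith
      · intro h
        simp at h
      · intro h
        simpa using hm i j (by simpa using h)
    · have e1 : (Fin.last (m + 2)) = (Fin.last (m + 1)).succ := rfl
      have e2 : (1 : Fin (m + 3)) = (0 : Fin (m + 2)).succ := rfl
      simp only [e1, e2, Fin.cons_zero, Fin.cons_succ]
      exact h4.le
    · rw [Fin.sum_univ_succ]; simp
    · ext i; simp [p]
  have h1 : 0 < volume U := hUo.measure_pos _ hUn
  have h2 := hp.hausdorffMeasure_image_le (d := (m + 2 : ℝ)) (by positivity) (selmerSimplexE m)
  simp only [ENNReal.coe_one, ENNReal.one_rpow, one_mul] at h2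
  rw [sel_pi] at h2
  exact h1.trans_le ((measure_mono hsub).trans h2)

lemma sel_key (m : ℕ) (t r : ℝ) (ht : 0 < t) (ht2 : t ≤ 1 / 16) (hr : 0 < r) (hrt : r ≤ t)
    (C : Fin (m + 3) → ℝ) (hC : ∀ i, 0 < C i)
    (B : Set (EuclideanSpace ℝ (Fin (m + 3)))) (hBm : MeasurableSet B)
    (hB : B = {v ∈ selmerSimplexE m | v 0 + v 1 - r * v 0 < v (Fin.last (m + 2))}) :
    ∫⁻ v in B, ENNReal.ofReal ((∑ i, C i * v i) ^ (m + 3))⁻¹ ∂(μH[(m + 2 : ℝ)]) ≤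
      ((1 + ‖selD m‖₊ : ℝ≥0) : ℝ≥0∞) ^ (m + 2 : ℝ) * 2 ^ (m + 3) *
      ∫⁻ v in {v ∈ selmerSimplexE m | 0 < v (Fin.last (m + 2)) - v 1 ∧
        t * (v (Fin.last (m + 2)) - v 1) ≤ v 0 + v 1 - v (Fin.last (m + 2)) ∧
        v 0 + v 1 - v (Fin.last (m + 2)) < 8 * t * (v (Fin.last (m + 2)) - v 1)},
        ENNReal.ofReal ((∑ i, C i * v i) ^ (m + 3))⁻¹ ∂(μH[(m + 2 : ℝ)]) := by
  set μ : Measure (EuclideanSpace ℝ (Fin (m + 3))) := μH[(m + 2 : ℝ)] with hμ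
  set K : ℝ≥0∞ := ((1 + ‖selD m‖₊ : ℝ≥0) : ℝ≥0∞) ^ (m + 2 : ℝ) with hK
  set f : EuclideanSpace ℝ (Fin (m + 3)) → ℝ≥0∞ :=
    fun v => ENNReal.ofReal ((∑ i, C i * v i) ^ (m + 3))⁻¹ with hf
  have hfm : Measurable f := by
    apply ENNReal.measurable_ofReal.comp
    apply Measurable.inv
    exact Continuous.measurable (by fun_prop)
  set s : ℝ := - (t / (1 - t)) with hs
  have h1t : (0 : ℝ) < 1 - t := by linarith
  have hs1 : |s| ≤ 1 := by
    rw [hs, abs_neg, abs_of_nonneg (by positivity), div_le_one h1t]; linarith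
  have hst : s + t = s * t := by rw [hs]; field_simp; ring
  have hgG : ∀ x, selL m s (selL m t x) = x := selL_comp m s t hst
  have hGg : ∀ x, selL m t (selL m s x) = x := selL_comp m t s (by linarith)
  have hgm : Measurable (selL m s) := (selL m s).continuous.measurable
  have hle : μ ≤ K • μ.map (selL m s) := by
    refine Measure.le_iff.2 fun E hE => ?_
    rw [Measure.smul_apply, Measure.map_apply hgm hE, smul_eq_mul]
    have := sel_lipschitz_le m s hs1 (selL m s ⁻¹' E)
    rwa [Set.image_preimage_eq _ (fun x => ⟨_, hgG x⟩)] at this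
  calc ∫⁻ v in B, f v ∂μ ≤ ∫⁻ v in B, f v ∂(K • μ.map (selL m s)) :=
        lintegral_mono' (Measure.restrict_mono le_rfl hle) le_rfl
    _ = K * ∫⁻ v in selL m s ⁻¹' B, f (selL m s v) ∂μ := by
        rw [Measure.restrict_smul, lintegral_smul_measure, smul_eq_mul, setLIntegral_map hBm hfm hgm]
    _ ≤ K * ∫⁻ v in selL m s ⁻¹' B, 2 ^ (m + 3) * f v ∂μ := by
        gcongr K * ?_
        refine setLIntegral_mono (by fun_prop) fun v hv => ?_
        rw [Set.mem_preimage, hB] at hv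
        obtain ⟨⟨q0, qm, -, qs⟩, -, -, -, hh⟩ := selL_mem m t r ht ht2 hr hrt _ hv.1 hv.2
        have hh := hh C hC
        rw [hGg] at hh q0 qm qs
        have hpos : 0 < ∑ i, C i * v i := by
          refine Finset.sum_pos' (fun i _ => mul_nonneg (hC i).le
            (q0.trans (qm 0 i (Fin.zero_le _)))) ?_
          by_contra! hcon
          have : ∀ i, v i ≤ 0 := by
            intro i
            have := hcon i (Finset.mem_univ _)
            by_contra! h
            nlinarith [mul_pos (hC i) h]
          have := Finset.sum_nonpos (s := Finset.univ) fun i _ => this i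
          linarith
        simp only [hf]
        rw [show (2 : ℝ≥0∞) ^ (m + 3) = ENNReal.ofReal (2 ^ (m + 3)) by
          rw [ENNReal.ofReal_pow (by norm_num)]; simp, ← ENNReal.ofReal_mul (by positivity)]
        apply ENNReal.ofReal_le_ofReal
        rw [← inv_inv ((2 : ℝ) ^ (m + 3)), ← mul_inv]
        apply inv_anti₀ (by positivity)
        rw [← inv_pow, ← mul_pow]
        gcongr
        linarith
    _ = K * 2 ^ (m + 3) * ∫⁻ v in selL m s ⁻¹' B, f v ∂μ := by
        rw [lintegral_const_mul _ hfm, mul_assoc]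
    _ ≤ _ := by
        gcongr
        intro v hv
        rw [Set.mem_preimage, hB] at hv
        obtain ⟨a1, a2, a3, a4, -⟩ := selL_mem m t r ht ht2 hr hrt _ hv.1 hv.2
        rw [hGg] at a1 a2 a3 a4
        exact ⟨a1, a2, a3, a4⟩

/-- There is a constant `r ∈ (0,1)`, depending only on the dimension, such that for all
positive `C[1],…,C[d]`, the integral of `(C[1]v[1]+⋯+C[d]v[d])^{−d}` over
`{v ∈ Ω₁ : v[d] > v[1]+v[2]−r·v[1]}` is less than half of its integral over `Ω₁`
(integrals with respect to the `(d−1)`-dimensional Hausdorff measure `λ₀`). -/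
theorem selmer_last_entry_not_big (m : ℕ) :
    ∃ r : ℝ, 0 < r ∧ r < 1 ∧ ∀ C : Fin (m + 3) → ℝ, (∀ i, 0 < C i) →
      (∫ v in {v ∈ selmerSimplexE m |
          v 0 + v 1 - r * v 0 < v (Fin.last (m + 2))},
          ((∑ i, C i * v i) ^ (m + 3))⁻¹ ∂(μH[(m + 2 : ℝ)])) <
        (1 / 2) * ∫ v in selmerSimplexE m,
          ((∑ i, C i * v i) ^ (m + 3))⁻¹ ∂(μH[(m + 2 : ℝ)]) := by
  set M : ℝ≥0∞ := ((1 + ‖selD m‖₊ : ℝ≥0) : ℝ≥0∞) ^ (m + 2 : ℝ) * 2 ^ (m + 3) with hM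
  have hMtop : M ≠ ⊤ := by
    refine ENNReal.mul_ne_top (ENNReal.rpow_ne_top_of_nonneg (by positivity) (by simp)) ?_
    exact ENNReal.pow_ne_top (by simp)
  obtain ⟨N, hN⟩ := exists_nat_gt (2 * M.toReal)
  set T : ℕ → ℝ := fun k => (1 / 16) ^ (k + 1) with hT
  have hTpos : ∀ k, 0 < T k := fun k => by simp only [hT]; positivity
  have hTle : ∀ k, T k ≤ 1 / 16 := fun k => by
    simp only [hT]
    exact pow_le_of_le_one (by norm_num) (by norm_num) (by simp)
  refine ⟨T N, hTpos N, lt_of_le_of_lt (hTle N) (by norm_num), fun C hC => ?_⟩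
  set r := T N with hr
  set μ : Measure (EuclideanSpace ℝ (Fin (m + 3))) := μH[(m + 2 : ℝ)] with hμ
  set Ω := selmerSimplexE m with hΩ
  set B : Set (EuclideanSpace ℝ (Fin (m + 3))) :=
    {v ∈ Ω | v 0 + v 1 - r * v 0 < v (Fin.last (m + 2))} with hB
  set f : EuclideanSpace ℝ (Fin (m + 3)) → ℝ := fun v => ((∑ i, C i * v i) ^ (m + 3))⁻¹ with hf
  have hΩm : MeasurableSet Ω := (selSimplex_closed m).measurableSet
  have hco : ∀ i : Fin (m + 3),
      Measurable (fun v : EuclideanSpace ℝ (Fin (m + 3)) => v i) :=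
    fun i => Continuous.measurable (by fun_prop)
  have hBm : MeasurableSet B :=
    hΩm.inter (measurableSet_lt (((hco 0).add (hco 1)).sub ((hco 0).const_mul r))
      (hco (Fin.last (m + 2))))
  have hfm : Measurable f := by
    apply Measurable.inv
    exact Continuous.measurable (by fun_prop)
  set E : ℕ → Set (EuclideanSpace ℝ (Fin (m + 3))) := fun k =>
    {v ∈ Ω | 0 < v (Fin.last (m + 2)) - v 1 ∧
        T k * (v (Fin.last (m + 2)) - v 1) ≤ v 0 + v 1 - v (Fin.last (m + 2)) ∧
        v 0 + v 1 - v (Fin.last (m + 2)) < 8 * T k * (v (Fin.last (m + 2)) - v 1)} with hE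
  have hEm : ∀ k, MeasurableSet (E k) := fun k =>
    hΩm.inter ((measurableSet_lt measurable_const ((hco (Fin.last (m + 2))).sub (hco 1))).inter
      ((measurableSet_le (((hco (Fin.last (m + 2))).sub (hco 1)).const_mul (T k))
        (((hco 0).add (hco 1)).sub (hco (Fin.last (m + 2))))).inter
      (measurableSet_lt (((hco 0).add (hco 1)).sub (hco (Fin.last (m + 2))))
        (((hco (Fin.last (m + 2))).sub (hco 1)).const_mul (8 * T k)))))
  have hlt : ∀ k l, k < l → Disjoint (E k) (E l) := by
    intro k l hkl
    rw [Set.disjoint_left]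
    rintro v ⟨-, a1, a2, -⟩ ⟨-, -, -, b3⟩
    have : 16 * T l ≤ T k := by
      have : T l ≤ T (k + 1) := pow_le_pow_of_le_one (by norm_num) (by norm_num) (by omega)
      have h2 : T (k + 1) = 1 / 16 * T k := by simp only [hT]; ring
      linarith
    nlinarith [hTpos l]
  have hEd : Pairwise (Function.onFun Disjoint E) := by
    intro k l hkl
    rcases lt_or_gt_of_ne hkl with h | h
    · exact hlt k l h
    · exact (hlt l k h).symm
  have hkey : ∀ k ∈ Finset.range N, ∫⁻ v in B, ENNReal.ofReal (f v) ∂μ ≤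
      M * ∫⁻ v in E k, ENNReal.ofReal (f v) ∂μ := by
    intro k hk
    refine sel_key m (T k) r (hTpos k) (hTle k) (hTpos N) ?_ C hC B hBm hB
    exact pow_le_pow_of_le_one (by norm_num) (by norm_num)
      (by have := Finset.mem_range.1 hk; omega)
  have hmain : (N : ℝ≥0∞) * ∫⁻ v in B, ENNReal.ofReal (f v) ∂μ ≤
      M * ∫⁻ v in Ω, ENNReal.ofReal (f v) ∂μ := by
    calc (N : ℝ≥0∞) * ∫⁻ v in B, ENNReal.ofReal (f v) ∂μ
        = ∑ k ∈ Finset.range N, ∫⁻ v in B, ENNReal.ofReal (f v) ∂μ := by simp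
      _ ≤ ∑ k ∈ Finset.range N, M * ∫⁻ v in E k, ENNReal.ofReal (f v) ∂μ :=
          Finset.sum_le_sum hkey
      _ = M * ∫⁻ v in ⋃ k ∈ Finset.range N, E k, ENNReal.ofReal (f v) ∂μ := by
          rw [← Finset.mul_sum, lintegral_biUnion_finset (fun i _ j _ h => hEd h)
            (fun i _ => hEm i)]
      _ ≤ _ := by
          gcongr
          exact Set.iUnion₂_subset fun k _ => fun v hv => hv.1
  -- positivity and boundedness of f on Ω
  obtain ⟨i₀, hi₀⟩ := Finite.exists_min C
  have hlow : ∀ v ∈ Ω, C i₀ ≤ ∑ i, C i * v i := by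
    rintro v ⟨q0, qm, -, qs⟩
    calc C i₀ = ∑ i, C i₀ * v i := by rw [← Finset.mul_sum, qs, mul_one]
      _ ≤ _ := Finset.sum_le_sum fun i _ =>
        mul_le_mul_of_nonneg_right (hi₀ i) (q0.trans (qm 0 i (Fin.zero_le _)))
  have hfpos : ∀ v ∈ Ω, 0 < f v := fun v hv => by
    have := (hC i₀).trans_le (hlow v hv)
    simp only [hf]; positivity
  have hfle : ∀ v ∈ Ω, f v ≤ (C i₀ ^ (m + 3))⁻¹ := fun v hv => by
    have h1 := hC i₀
    have := hlow v hv
    simp only [hf]; gcongr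
  have hint : IntegrableOn f Ω μ := by
    refine Measure.integrableOn_of_bounded (M := (C i₀ ^ (m + 3))⁻¹)
      (selSimplex_lt_top m).ne hfm.aestronglyMeasurable ?_
    refine (ae_restrict_iff' hΩm).2 (Filter.Eventually.of_forall fun v hv => ?_)
    rw [Real.norm_of_nonneg (hfpos v hv).le]
    exact hfle v hv
  have hBsub : B ⊆ Ω := fun v hv => hv.1
  have hintB : IntegrableOn f B μ := hint.mono_set hBsub
  have hnnΩ : 0 ≤ᵐ[μ.restrict Ω] f :=
    (ae_restrict_iff' hΩm).2 (Filter.Eventually.of_forall fun v hv => (hfpos v hv).le)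
  have hnnB : 0 ≤ᵐ[μ.restrict B] f :=
    (ae_restrict_iff' hBm).2 (Filter.Eventually.of_forall fun v hv => (hfpos v (hBsub hv)).le)
  have hIpos : 0 < ∫ v in Ω, f v ∂μ := by
    rw [setIntegral_pos_iff_support_of_nonneg_ae hnnΩ hint]
    have : Function.support f ∩ Ω = Ω :=
      Set.inter_eq_right.2 fun v hv => (hfpos v hv).ne'
    rw [this]
    exact selSimplex_pos m
  rw [← ofReal_integral_eq_lintegral_ofReal hintB hnnB,
    ← ofReal_integral_eq_lintegral_ofReal hint hnnΩ] at hmain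
  have hreal := ENNReal.toReal_mono (ENNReal.mul_ne_top hMtop ENNReal.ofReal_ne_top) hmain
  rw [ENNReal.toReal_mul, ENNReal.toReal_mul, ENNReal.toReal_natCast,
    ENNReal.toReal_ofReal (integral_nonneg_of_ae hnnB),
    ENNReal.toReal_ofReal hIpos.le] at hreal
  have hM0 : 0 ≤ M.toReal := ENNReal.toReal_nonneg
  by_contra! hcon
  have h5 : (N : ℝ) * (1 / 2 * ∫ v in Ω, f v ∂μ) ≤ N * ∫ v in B, f v ∂μ := by gcongr
  nlinarith
end
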